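/- arXiv:2208.11665 — 6 statements merged into one kernel-verified Lean document; each statement's English description precedes it below -/
import Mathlib

section
/- Assume (A1), (A4) and (A5). If η is a curve in Z, then γ : [0,1] → M defined by γ_t := φ(η_t) is a curve in M. -/
open Set
open scoped RealInnerProductSpace

noncomputable section

/-- `C¹` on an arbitrary domain `U` (Guillemin–Pollack): around every point of `U`
there is an open set on which `ψ` admits a `C¹` extension. -/
def C1OnSet {E F : Type*} [NormedAddCommGroup E] [NormedSpace ℝ E]
    [NormedAddCommGroup F] [NormedSpace ℝ F] (ψ : E → F) (U : Set E) : Prop :=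
  ∀ ξ ∈ U, ∃ V : Set E, IsOpen V ∧ ξ ∈ V ∧
    ∃ g : E → F, ContDiffOn ℝ 1 g V ∧ Set.EqOn g ψ (V ∩ U)

/-- A diffeomorphism from an open set `V` onto an arbitrary set `U`: a homeomorphism
`V → U` which is continuously differentiable on `V` and whose inverse is `C¹` on `U`. -/
def IsDiffeoOnto {E F : Type*} [NormedAddCommGroup E] [NormedSpace ℝ E]
    [NormedAddCommGroup F] [NormedSpace ℝ F] (ψ : E → F) (V : Set E) (U : Set F) : Prop :=
  Set.BijOn ψ V U ∧ ContinuousOn ψ V ∧ ContDiffOn ℝ 1 ψ V ∧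
    ∃ ψinv : F → E, (∀ x ∈ V, ψinv (ψ x) = x) ∧ (∀ y ∈ U, ψ (ψinv y) = y) ∧
      ContinuousOn ψinv U ∧ C1OnSet ψinv U

/-- `Z ⊆ ℝ^{d̃}` is a `d`-dimensional differentiable manifold: every point has a
relatively open piece diffeomorphic to an open subset of `ℝ^d`. -/
def IsManifoldOfDim {dt : ℕ} (d : ℕ) (Z : Set (EuclideanSpace ℝ (Fin dt))) : Prop :=
  ∀ a ∈ Z, ∃ U : Set (EuclideanSpace ℝ (Fin dt)), U ⊆ Z ∧ a ∈ U ∧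
    ∃ V : Set (EuclideanSpace ℝ (Fin d)), IsOpen V ∧
      ∃ ψ : EuclideanSpace ℝ (Fin d) → EuclideanSpace ℝ (Fin dt), IsDiffeoOnto ψ V U

/-- A curve in a subset `M` of a real normed space: a map `γ : [0,1] → M`, continuous,
with a derivative `γ'` (limit of difference quotients within `[0,1]`) at every
`t ∈ [0,1]`, depending continuously on `t`. -/
def IsCurveIn {H : Type*} [NormedAddCommGroup H] [NormedSpace ℝ H]
    (M : Set H) (γ γ' : ℝ → H) : Prop :=
  (∀ t ∈ Set.Icc (0:ℝ) 1, γ t ∈ M) ∧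
  ContinuousOn γ (Set.Icc (0:ℝ) 1) ∧
  (∀ t ∈ Set.Icc (0:ℝ) 1, HasDerivWithinAt γ (γ' t) (Set.Icc (0:ℝ) 1) t) ∧
  ContinuousOn γ' (Set.Icc (0:ℝ) 1)

/-- The data and assumptions (A1), (A4), (A5) of the Latent Metric Space geometry:
a compact latent set `Zset ⊆ ℝ^{d̃}` which is a `d`-dimensional differentiable manifold,
the mean correlation kernel `f` with Mercer feature map `phi : Zset → ℓ²`,
an open set `Zt ⊇ Zset` together with an extension `F` of `f`, with first partial
derivatives `g1` (in the second argument) and symmetric continuous mixed partial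
derivatives `Hm` on `Zt × Zt`, such that `H_ξ = Hm ξ ξ` is positive-definite on `Zset`. -/
structure LatentGeometry (d dt : ℕ) where
  Zset : Set (EuclideanSpace ℝ (Fin dt))
  phi : EuclideanSpace ℝ (Fin dt) → lp (fun _ : ℕ => ℝ) 2
  f : EuclideanSpace ℝ (Fin dt) → EuclideanSpace ℝ (Fin dt) → ℝ
  Zt : Set (EuclideanSpace ℝ (Fin dt))
  F : EuclideanSpace ℝ (Fin dt) → EuclideanSpace ℝ (Fin dt) → ℝ
  g1 : EuclideanSpace ℝ (Fin dt) → EuclideanSpace ℝ (Fin dt) → Fin dt → ℝ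
  Hm : EuclideanSpace ℝ (Fin dt) → EuclideanSpace ℝ (Fin dt) → Matrix (Fin dt) (Fin dt) ℝ
  hd : d ≤ dt
  compact : IsCompact Zset
  nonempty : Zset.Nonempty
  kernel_eq : ∀ z ∈ Zset, ∀ z' ∈ Zset, f z z' = ⟪phi z, phi z'⟫
  -- (A1)
  contf : ContinuousOn
    (fun zz : EuclideanSpace ℝ (Fin dt) × EuclideanSpace ℝ (Fin dt) => f zz.1 zz.2)
    (Zset ×ˢ Zset)
  -- (A4)
  distinguish : ∀ z ∈ Zset, ∀ z' ∈ Zset, z ≠ z' → ∃ ξ ∈ Zset, f z ξ ≠ f z' ξ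
  -- (A5)
  manifold : IsManifoldOfDim d Zset
  Zt_open : IsOpen Zt
  subset_Zt : Zset ⊆ Zt
  F_eq : ∀ z ∈ Zset, ∀ z' ∈ Zset, F z z' = f z z'
  hg1 : ∀ (j : Fin dt), ∀ z ∈ Zt, ∀ z' ∈ Zt,
    HasDerivAt (fun t : ℝ => F z (z' + t • EuclideanSpace.single j (1:ℝ))) (g1 z z' j) 0
  hHm : ∀ (i j : Fin dt), ∀ z ∈ Zt, ∀ z' ∈ Zt,
    HasDerivAt (fun t : ℝ => g1 (z + t • EuclideanSpace.single i (1:ℝ)) z' j) (Hm z z' i j) 0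
  Hm_symm : ∀ z ∈ Zt, ∀ z' ∈ Zt, ∀ i j, Hm z z' i j = Hm z' z j i
  Hm_cont : ∀ i j, ContinuousOn
    (fun zz : EuclideanSpace ℝ (Fin dt) × EuclideanSpace ℝ (Fin dt) => Hm zz.1 zz.2 i j)
    (Zt ×ˢ Zt)
  Hm_posdef : ∀ ξ ∈ Zset, (Hm ξ ξ).PosDef

section PartialDerivatives

variable {ι : Type*}

/-- The open box of half-width `r` around `a`. -/
def openBox (a : EuclideanSpace ℝ ι) (r : ℝ) : Set (EuclideanSpace ℝ ι) :=
  {z | ∀ i, z i ∈ Metric.ball (a i) r}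

theorem abs_sub_le_of_partial_le_single [DecidableEq ι] {a : EuclideanSpace ℝ ι} {r C : ℝ}
    {u : EuclideanSpace ℝ ι → ℝ} {u' : EuclideanSpace ℝ ι → ι → ℝ}
    (hu : ∀ z ∈ openBox a r, ∀ j,
      HasDerivAt (fun t : ℝ => u (z + t • EuclideanSpace.single j (1 : ℝ))) (u' z j) 0)
    (hC : ∀ z ∈ openBox a r, ∀ j, |u' z j| ≤ C)
    {z : EuclideanSpace ℝ ι} (hz : z ∈ openBox a r) (j : ι) {x : ℝ}
    (hx : z + x • EuclideanSpace.single j (1 : ℝ) ∈ openBox a r) :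
    |u (z + x • EuclideanSpace.single j (1 : ℝ)) - u z| ≤ C * |x| := by
  let s : Set ℝ := {t | z j + t ∈ Metric.ball (a j) r}
  have hs : Convex ℝ s := (convex_ball (a j) r).translate_preimage_right (z j)
  have hmem : ∀ t ∈ s, z + t • EuclideanSpace.single j (1 : ℝ) ∈ openBox a r := by
    intro t ht i
    by_cases hij : i = j
    · subst hij
      simpa [s] using ht
    · simpa [hij] using hz i
  have hder : ∀ t ∈ s, HasDerivWithinAt
      (fun t : ℝ => u (z + t • EuclideanSpace.single j (1 : ℝ)))
      (u' (z + t • EuclideanSpace.single j (1 : ℝ)) j) s t := by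
    intro t ht
    have h := hu _ (hmem t ht) j
    rw [← sub_self t] at h
    refine (h.comp_sub_const t t).hasDerivWithinAt.congr_of_eventuallyEq ?_ ?_
    · refine Filter.Eventually.of_forall fun y => ?_
      simp only [add_assoc, ← add_smul, add_sub_cancel]
    · simp
  have h0 : (0 : ℝ) ∈ s := by simpa [s] using hz j
  have hxs : x ∈ s := by simpa [s] using hx j
  have := hs.norm_image_sub_le_of_norm_hasDerivWithin_le hder
    (fun t ht => hC _ (hmem t ht) j) h0 hxs
  simpa using this

theorem abs_sub_le_of_partial_le [Fintype ι] [DecidableEq ι] {a : EuclideanSpace ℝ ι} {r C : ℝ}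
    {u : EuclideanSpace ℝ ι → ℝ} {u' : EuclideanSpace ℝ ι → ι → ℝ}
    (hu : ∀ z ∈ openBox a r, ∀ j,
      HasDerivAt (fun t : ℝ => u (z + t • EuclideanSpace.single j (1 : ℝ))) (u' z j) 0)
    (hC : ∀ z ∈ openBox a r, ∀ j, |u' z j| ≤ C)
    {z w : EuclideanSpace ℝ ι} (hz : z ∈ openBox a r) (hw : w ∈ openBox a r) :
    |u w - u z| ≤ C * ∑ j, |w j - z j| := by
  let P : Finset ι → EuclideanSpace ℝ ι := fun S => WithLp.toLp 2 fun i => if i ∈ S then w i else z i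
  have hP : ∀ S, P S ∈ openBox a r := by
    intro S i
    by_cases h : i ∈ S
    · simpa [P, h] using hw i
    · simpa [P, h] using hz i
  have key : ∀ S : Finset ι, |u (P S) - u z| ≤ C * ∑ j ∈ S, |w j - z j| := by
    intro S
    induction S using Finset.induction_on with
    | empty =>
      have : P ∅ = z := by ext i; simp [P]
      simp [this]
    | insert j S hj ih =>
      have hstep : P (insert j S) = P S + (w j - z j) • EuclideanSpace.single j (1 : ℝ) := by
        ext i
        by_cases hij : i = j
        · subst hij
          simp [P, hj]
        · simp [P, hij]
      have h := abs_sub_le_of_partial_le_single hu hC (hP S) j (hstep ▸ hP (insert j S))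
      rw [← hstep] at h
      rw [Finset.sum_insert hj, mul_add]
      exact (abs_sub_le _ (u (P S)) _).trans (add_le_add h ih)
  have hPw : P Finset.univ = w := by ext i; simp [P]
  simpa [hPw] using key Finset.univ

theorem hasDerivAt_sum_mul_add_single [Fintype ι] [DecidableEq ι] (c : ι → ℝ) (z : EuclideanSpace ℝ ι) (j : ι) :
    HasDerivAt (fun t : ℝ => ∑ i, c i * (z + t • EuclideanSpace.single j (1 : ℝ)) i) (c j) 0 := by
  have h : (fun t : ℝ => ∑ i, c i * (z + t • EuclideanSpace.single j (1 : ℝ)) i)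
      = fun t => (∑ i, c i * z i) + t * c j := by
    funext t
    simp [mul_add, Finset.sum_add_distrib, mul_comm]
  rw [h]
  simpa using ((hasDerivAt_id (0 : ℝ)).mul_const (c j)).const_add (∑ i, c i * z i)

/-- Second differences of a function whose mixed partial derivatives are close to a constant
matrix are close to the corresponding bilinear form. -/
theorem abs_second_difference_sub_le [Fintype ι] [DecidableEq ι] {a : EuclideanSpace ℝ ι} {r ε : ℝ}
    {F : EuclideanSpace ℝ ι → EuclideanSpace ℝ ι → ℝ}
    {g : EuclideanSpace ℝ ι → EuclideanSpace ℝ ι → ι → ℝ}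
    {H : EuclideanSpace ℝ ι → EuclideanSpace ℝ ι → Matrix ι ι ℝ} {A : Matrix ι ι ℝ}
    (hg : ∀ j, ∀ z ∈ openBox a r, ∀ w ∈ openBox a r,
      HasDerivAt (fun t : ℝ => F z (w + t • EuclideanSpace.single j (1 : ℝ))) (g z w j) 0)
    (hH : ∀ i j, ∀ z ∈ openBox a r, ∀ w ∈ openBox a r,
      HasDerivAt (fun t : ℝ => g (z + t • EuclideanSpace.single i (1 : ℝ)) w j) (H z w i j) 0)
    (hA : ∀ z ∈ openBox a r, ∀ w ∈ openBox a r, ∀ i j, |H z w i j - A i j| ≤ ε)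
    {z z₀ w w₀ : EuclideanSpace ℝ ι} (hz : z ∈ openBox a r) (hz₀ : z₀ ∈ openBox a r)
    (hw : w ∈ openBox a r) (hw₀ : w₀ ∈ openBox a r) :
    |(F z w - F z₀ w - (F z w₀ - F z₀ w₀)) - ∑ j, (∑ i, A i j * (z i - z₀ i)) * (w j - w₀ j)|
      ≤ ε * (∑ i, |z i - z₀ i|) * ∑ j, |w j - w₀ j| := by
  have hinner : ∀ y ∈ openBox a r, ∀ j,
      |g z y j - g z₀ y j - ∑ i, A i j * (z i - z₀ i)| ≤ ε * ∑ i, |z i - z₀ i| := by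
    intro y hy j
    have h := abs_sub_le_of_partial_le (u := fun x => g x y j - ∑ i, A i j * x i)
      (u' := fun x i => H x y i j - A i j)
      (fun x hx i => (hH i j x hx y hy).sub
        (hasDerivAt_sum_mul_add_single (fun i => A i j) x i))
      (fun x hx i => hA x hx y hy i j) hz₀ hz
    convert h using 2
    simp only [mul_sub, Finset.sum_sub_distrib]
    ring
  have h := abs_sub_le_of_partial_le
    (u := fun y => F z y - F z₀ y - ∑ j, (∑ i, A i j * (z i - z₀ i)) * y j)
    (u' := fun y j => g z y j - g z₀ y j - ∑ i, A i j * (z i - z₀ i))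
    (fun y hy j => ((hg j z hz y hy).sub (hg j z₀ hz₀ y hy)).sub
      (hasDerivAt_sum_mul_add_single _ y j))
    hinner hw₀ hw
  convert h using 2
  simp only [mul_sub, Finset.sum_sub_distrib]
  ring

theorem openBox_mem_nhds [Fintype ι] (a : EuclideanSpace ℝ ι) {r : ℝ} (hr : 0 < r) :
    openBox a r ∈ nhds a := by
  have h : ∀ᶠ z in nhds a, ∀ i, z i ∈ Metric.ball (a i) r :=
    Filter.eventually_all.2 fun i =>
      (EuclideanSpace.proj (𝕜 := ℝ) i).continuous.continuousAt.eventually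
        (Metric.ball_mem_nhds _ hr)
  exact h

theorem exists_openBox_subset [Fintype ι] {a : EuclideanSpace ℝ ι} {U : Set (EuclideanSpace ℝ ι)}
    (hU : U ∈ nhds a) : ∃ r > 0, openBox a r ⊆ U := by
  have hc : Filter.Tendsto (WithLp.toLp 2 : (ι → ℝ) → EuclideanSpace ℝ ι)
      (nhds (WithLp.ofLp a)) (nhds a) :=
    (PiLp.continuous_toLp 2 _).continuousAt
  obtain ⟨r, hr, h⟩ := Metric.mem_nhds_iff.1 (hc hU)
  refine ⟨r, hr, fun z hz => ?_⟩
  exact h (show WithLp.ofLp z ∈ _ from (dist_pi_lt_iff hr).2 hz)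

end PartialDerivatives

section Slopes

/-- Pairs of distinct points of `S` near `(t, t)`. -/
def pairFilter (S : Set ℝ) (t : ℝ) : Filter (ℝ × ℝ) :=
  nhdsWithin (t, t) {p | p.1 ∈ S ∧ p.2 ∈ S ∧ p.1 ≠ p.2}

theorem tendsto_prodMk_pairFilter {S : Set ℝ} {t : ℝ} (ht : t ∈ S) :
    Filter.Tendsto (fun s => (t, s)) (nhdsWithin t (S \ {t})) (pairFilter S t) := by
  refine tendsto_nhdsWithin_iff.2 ⟨?_, ?_⟩
  · exact (Continuous.prodMk_right t).continuousAt.mono_left nhdsWithin_le_nhds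
  · filter_upwards [self_mem_nhdsWithin] with s hs
    exact ⟨ht, hs.1, fun h => hs.2 h.symm⟩

theorem nhdsWithin_Icc_diff_neBot {t : ℝ} (ht : t ∈ Icc (0 : ℝ) 1) :
    (nhdsWithin t (Icc (0 : ℝ) 1 \ {t})).NeBot := by
  have h := uniqueDiffWithinAt_iff_accPt.1 (uniqueDiffOn_Icc (zero_lt_one' ℝ) t ht)
  rwa [accPt_principal_iff_nhdsWithin] at h

theorem pairFilter_neBot {t : ℝ} (ht : t ∈ Icc (0 : ℝ) 1) : (pairFilter (Icc 0 1) t).NeBot :=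
  have := nhdsWithin_Icc_diff_neBot ht
  (tendsto_prodMk_pairFilter ht).neBot

theorem tendsto_slope_pairFilter {E : Type*} [NormedAddCommGroup E] [NormedSpace ℝ E]
    {S : Set ℝ} (hS : Convex ℝ S) {γ γ' : ℝ → E}
    (hγ : ∀ t ∈ S, HasDerivWithinAt γ (γ' t) S t) (hc : ContinuousOn γ' S) {t : ℝ} (ht : t ∈ S) :
    Filter.Tendsto (fun p : ℝ × ℝ => slope γ p.1 p.2) (pairFilter S t) (nhds (γ' t)) := by
  refine Metric.tendsto_nhds.2 fun ε hε => ?_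
  obtain ⟨δ, hδ, h⟩ := Metric.continuousOn_iff.1 hc t ht (ε / 2) (half_pos hε)
  have hball : Metric.ball t δ ×ˢ Metric.ball t δ ∈ nhds (t, t) :=
    prod_mem_nhds (Metric.ball_mem_nhds _ hδ) (Metric.ball_mem_nhds _ hδ)
  filter_upwards [mem_nhdsWithin_of_mem_nhds hball, self_mem_nhdsWithin] with p hp hpS
  obtain ⟨h1, h2, hne⟩ := hpS
  have hle := (hS.inter (convex_ball t δ)).norm_image_sub_le_of_norm_hasDerivWithin_le
    (f := fun s => γ s - s • γ' t) (f' := fun s => γ' s - (1 : ℝ) • γ' t) (C := ε / 2)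
    (fun s hs => ((hγ s hs.1).mono inter_subset_left).sub
      ((hasDerivWithinAt_id s _).smul_const (γ' t)))
    (fun s hs => by
      rw [one_smul, ← dist_eq_norm]
      exact (h s hs.1 hs.2).le)
    ⟨h1, hp.1⟩ ⟨h2, hp.2⟩
  have hpos : 0 < ‖p.2 - p.1‖ := norm_pos_iff.2 (sub_ne_zero.2 hne.symm)
  have heq : (p.2 - p.1) • (slope γ p.1 p.2 - γ' t)
      = γ p.2 - p.2 • γ' t - (γ p.1 - p.1 • γ' t) := by
    rw [smul_sub, sub_smul_slope, vsub_eq_sub, sub_smul]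
    abel
  rw [← heq, norm_smul, mul_comm] at hle
  rw [dist_eq_norm]
  exact (le_of_mul_le_mul_right hle hpos).trans_lt (half_lt_self hε)

/-- If the difference quotients of `γ` over pairs of points converge at every point of `[0,1]`,
then `γ` is continuously differentiable on `[0,1]`. -/
theorem isCurveIn_of_tendsto_slope {H : Type*} [NormedAddCommGroup H] [NormedSpace ℝ H]
    {M : Set H} {γ γ' : ℝ → H} (hM : ∀ t ∈ Icc (0 : ℝ) 1, γ t ∈ M)
    (h : ∀ t ∈ Icc (0 : ℝ) 1, Filter.Tendsto (fun p : ℝ × ℝ => slope γ p.1 p.2)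
      (pairFilter (Icc 0 1) t) (nhds (γ' t))) :
    IsCurveIn M γ γ' := by
  have hd : ∀ t ∈ Icc (0 : ℝ) 1, HasDerivWithinAt γ (γ' t) (Icc 0 1) t := fun t ht =>
    hasDerivWithinAt_iff_tendsto_slope.2 ((h t ht).comp (tendsto_prodMk_pairFilter ht))
  refine ⟨hM, fun t ht => (hd t ht).continuousWithinAt, hd, fun t ht => ?_⟩
  refine Metric.tendsto_nhds.2 fun ε hε => ?_
  have hev := Metric.tendsto_nhds.1 (h t ht) (ε / 2) (half_pos hε)
  have hev' := eventually_nhdsWithin_iff.1 hev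
  have hdiag : Filter.Tendsto (fun s : ℝ => (s, s)) (nhds t) (nhds (t, t)) :=
    (continuous_id.prodMk continuous_id).continuousAt
  filter_upwards [self_mem_nhdsWithin, mem_nhdsWithin_of_mem_nhds
    (hdiag.eventually (eventually_eventually_nhds.2 hev'))] with s hs hnear
  have := pairFilter_neBot hs
  have hle := le_of_tendsto ((h s hs).dist tendsto_const_nhds)
    ((eventually_nhdsWithin_iff.2 hnear).mono fun p hp => hp.le)
  exact hle.trans_lt (half_lt_self hε)

theorem exists_tendsto_of_tendsto_inner {α H : Type*} [NormedAddCommGroup H]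
    [InnerProductSpace ℝ H] [CompleteSpace H] {l : Filter α} [l.NeBot] {q : α → H} {c : ℝ}
    (h : Filter.Tendsto (fun p : α × α => ⟪q p.1, q p.2⟫) (l ×ˢ l) (nhds c)) :
    ∃ v, Filter.Tendsto q l (nhds v) := by
  refine cauchy_map_iff_exists_tendsto.1 (cauchy_map_iff.2 ⟨‹_›, ?_⟩)
  rw [tendsto_uniformity_iff_dist_tendsto_zero]
  have hdiag : Filter.Tendsto (fun x : α => ⟪q x, q x⟫) l (nhds c) :=
    h.comp (Filter.tendsto_id.prodMk Filter.tendsto_id)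
  have hsq : Filter.Tendsto (fun p : α × α => ‖q p.1 - q p.2‖ ^ 2) (l ×ˢ l) (nhds 0) := by
    have := ((hdiag.comp Filter.tendsto_fst).sub (h.const_mul 2)).add
      (hdiag.comp (Filter.tendsto_snd (f := l) (g := l)))
    convert this using 2 with p
    · rw [norm_sub_sq_real, ← real_inner_self_eq_norm_sq, ← real_inner_self_eq_norm_sq]
      rfl
    · ring
  have := hsq.sqrt
  simpa [dist_eq_norm] using this

end Slopes

namespace LatentGeometry

variable {d dt : ℕ} (G : LatentGeometry d dt)

theorem inner_sub_sub_eq {z z₀ w w₀ : EuclideanSpace ℝ (Fin dt)} (hz : z ∈ G.Zset)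
    (hz₀ : z₀ ∈ G.Zset) (hw : w ∈ G.Zset) (hw₀ : w₀ ∈ G.Zset) :
    ⟪G.phi z - G.phi z₀, G.phi w - G.phi w₀⟫ = G.F z w - G.F z₀ w - (G.F z w₀ - G.F z₀ w₀) := by
  rw [G.F_eq z hz w hw, G.F_eq z₀ hz₀ w hw, G.F_eq z hz w₀ hw₀, G.F_eq z₀ hz₀ w₀ hw₀,
    G.kernel_eq z hz w hw, G.kernel_eq z₀ hz₀ w hw, G.kernel_eq z hz w₀ hw₀,
    G.kernel_eq z₀ hz₀ w₀ hw₀]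
  simp only [inner_sub_left, inner_sub_right]

theorem exists_openBox_abs_Hm_sub_le {a : EuclideanSpace ℝ (Fin dt)} (ha : a ∈ G.Zset) {ε : ℝ}
    (hε : 0 < ε) : ∃ r > 0, openBox a r ⊆ G.Zt ∧ ∀ z ∈ openBox a r, ∀ w ∈ openBox a r,
      ∀ i j, |G.Hm z w i j - G.Hm a a i j| ≤ ε := by
  have hZt : G.Zt ∈ nhds a := G.Zt_open.mem_nhds (G.subset_Zt ha)
  have hH : ∀ᶠ p in nhds a ×ˢ nhds a, ∀ i j, |G.Hm p.1 p.2 i j - G.Hm a a i j| ≤ ε := by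
    refine Filter.eventually_all.2 fun i => Filter.eventually_all.2 fun j => ?_
    rw [← nhds_prod_eq]
    have hc := (G.Hm_cont i j).continuousAt (prod_mem_nhds hZt hZt)
    filter_upwards [Metric.tendsto_nhds.1 hc ε hε] with p hp
    exact hp.le
  obtain ⟨U, hU, hUH⟩ := Filter.eventually_prod_self_iff
    (r := fun z w => ∀ i j, |G.Hm z w i j - G.Hm a a i j| ≤ ε) |>.1 hH
  obtain ⟨r, hr, hsub⟩ := exists_openBox_subset (Filter.inter_mem hU hZt)
  exact ⟨r, hr, fun z hz => (hsub hz).2, fun z hz w hw => hUH z (hsub hz).1 w (hsub hw).1⟩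

theorem exists_openBox_abs_inner_sub_le {a : EuclideanSpace ℝ (Fin dt)} (ha : a ∈ G.Zset) {ε : ℝ}
    (hε : 0 < ε) : ∃ r > 0, ∀ z ∈ G.Zset ∩ openBox a r, ∀ z₀ ∈ G.Zset ∩ openBox a r,
      ∀ w ∈ G.Zset ∩ openBox a r, ∀ w₀ ∈ G.Zset ∩ openBox a r,
      |⟪G.phi z - G.phi z₀, G.phi w - G.phi w₀⟫
          - ∑ j, (∑ i, G.Hm a a i j * (z i - z₀ i)) * (w j - w₀ j)|
        ≤ ε * ((∑ i, |z i - z₀ i|) * ∑ j, |w j - w₀ j|) := by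
  obtain ⟨r, hr, hsub, hH⟩ := G.exists_openBox_abs_Hm_sub_le ha hε
  refine ⟨r, hr, fun z hz z₀ hz₀ w hw w₀ hw₀ => ?_⟩
  rw [G.inner_sub_sub_eq hz.1 hz₀.1 hw.1 hw₀.1, ← mul_assoc]
  exact abs_second_difference_sub_le
    (fun j z hz w hw => G.hg1 j z (hsub hz) w (hsub hw))
    (fun i j z hz w hw => G.hHm i j z (hsub hz) w (hsub hw)) hH hz.2 hz₀.2 hw.2 hw₀.2

theorem abs_inner_slope_sub_le {η : ℝ → EuclideanSpace ℝ (Fin dt)} {A : Matrix (Fin dt) (Fin dt) ℝ}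
    {ε s t s' t' : ℝ}
    (h : |⟪G.phi (η s) - G.phi (η t), G.phi (η s') - G.phi (η t')⟫
          - ∑ j, (∑ i, A i j * (η s i - η t i)) * (η s' j - η t' j)|
        ≤ ε * ((∑ i, |η s i - η t i|) * ∑ j, |η s' j - η t' j|)) :
    |⟪slope (fun x => G.phi (η x)) t s, slope (fun x => G.phi (η x)) t' s'⟫
          - ∑ j, (∑ i, A i j * slope η t s i) * slope η t' s' j|
        ≤ ε * ((∑ i, |slope η t s i|) * ∑ j, |slope η t' s' j|) := by
  have hk : 0 ≤ |(s - t)⁻¹ * (s' - t')⁻¹| := abs_nonneg _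
  have h' := mul_le_mul_of_nonneg_left h hk
  rw [← abs_mul] at h'
  refine (le_of_eq ?_).trans (h'.trans_eq ?_)
  · congr 1
    simp only [slope_def_module, PiLp.smul_apply, PiLp.sub_apply, smul_eq_mul, mul_sub (_ * _),
      real_inner_smul_left, real_inner_smul_right, Finset.mul_sum, Finset.sum_mul]
    congr 1
    · ring
    · refine Finset.sum_congr rfl fun j _ => Finset.sum_congr rfl fun i _ => ?_
      ring
  · simp only [slope_def_module, PiLp.smul_apply, PiLp.sub_apply, smul_eq_mul, abs_mul,
      ← Finset.mul_sum]
    ring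

theorem tendsto_inner_slope {η η' : ℝ → EuclideanSpace ℝ (Fin dt)} (hη : IsCurveIn G.Zset η η')
    {t : ℝ} (ht : t ∈ Icc (0 : ℝ) 1) :
    ∃ c, Filter.Tendsto (fun p : (ℝ × ℝ) × (ℝ × ℝ) =>
      ⟪slope (fun x => G.phi (η x)) p.1.1 p.1.2, slope (fun x => G.phi (η x)) p.2.1 p.2.2⟫)
      (pairFilter (Icc 0 1) t ×ˢ pairFilter (Icc 0 1) t) (nhds c) := by
  obtain ⟨hZ, hc, hd, hd'⟩ := hη
  let L := pairFilter (Icc 0 1) t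
  let A := G.Hm (η t) (η t)
  have hslope : ∀ i, Filter.Tendsto (fun p : ℝ × ℝ => slope η p.1 p.2 i) L (nhds (η' t i)) :=
    fun i => ((EuclideanSpace.proj (𝕜 := ℝ) i).continuous.tendsto _).comp
      (tendsto_slope_pairFilter (convex_Icc 0 1) hd hd' ht)
  have hfst : ∀ i, Filter.Tendsto (fun p : (ℝ × ℝ) × (ℝ × ℝ) => slope η p.1.1 p.1.2 i) (L ×ˢ L)
      (nhds (η' t i)) := fun i => (hslope i).comp Filter.tendsto_fst
  have hsnd : ∀ i, Filter.Tendsto (fun p : (ℝ × ℝ) × (ℝ × ℝ) => slope η p.2.1 p.2.2 i) (L ×ˢ L)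
      (nhds (η' t i)) := fun i => (hslope i).comp Filter.tendsto_snd
  have hform : Filter.Tendsto (fun p : (ℝ × ℝ) × (ℝ × ℝ) =>
      ∑ j, (∑ i, A i j * slope η p.1.1 p.1.2 i) * slope η p.2.1 p.2.2 j) (L ×ˢ L)
      (nhds (∑ j, (∑ i, A i j * η' t i) * η' t j)) :=
    tendsto_finsetSum _ fun j _ =>
      (tendsto_finsetSum _ fun i _ => (hfst i).const_mul (A i j)).mul (hsnd j)
  have hsize : Filter.Tendsto (fun p : (ℝ × ℝ) × (ℝ × ℝ) =>
      (∑ i, |slope η p.1.1 p.1.2 i|) * ∑ j, |slope η p.2.1 p.2.2 j|) (L ×ˢ L)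
      (nhds ((∑ i, |η' t i|) * ∑ j, |η' t j|)) :=
    (tendsto_finsetSum _ fun i _ => (hfst i).abs).mul (tendsto_finsetSum _ fun j _ => (hsnd j).abs)
  have hdiff : (fun p : (ℝ × ℝ) × (ℝ × ℝ) =>
      ⟪slope (fun x => G.phi (η x)) p.1.1 p.1.2, slope (fun x => G.phi (η x)) p.2.1 p.2.2⟫
        - ∑ j, (∑ i, A i j * slope η p.1.1 p.1.2 i) * slope η p.2.1 p.2.2 j)
      =o[L ×ˢ L] fun p => (∑ i, |slope η p.1.1 p.1.2 i|) * ∑ j, |slope η p.2.1 p.2.2 j| := by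
    refine Asymptotics.isLittleO_iff.2 fun ε hε => ?_
    obtain ⟨r, hr, hbound⟩ := G.exists_openBox_abs_inner_sub_le (hZ t ht) hε
    have hbox : ∀ᶠ s in nhdsWithin t (Icc 0 1), η s ∈ openBox (η t) r :=
      hc t ht (openBox_mem_nhds _ hr)
    have hev : ∀ᶠ p in L, η p.1 ∈ G.Zset ∩ openBox (η t) r ∧
        η p.2 ∈ G.Zset ∩ openBox (η t) r := by
      have h1 := eventually_nhdsWithin_iff.1 hbox
      filter_upwards [self_mem_nhdsWithin, mem_nhdsWithin_of_mem_nhds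
        (prod_mem_nhds h1 h1)] with p hp hp'
      exact ⟨⟨hZ _ hp.1, hp'.1 hp.1⟩, hZ _ hp.2.1, hp'.2 hp.2.1⟩
    filter_upwards [hev.prod_mk hev] with p hp
    obtain ⟨⟨h1, h2⟩, h1', h2'⟩ := hp
    refine (G.abs_inner_slope_sub_le (hbound _ h2 _ h1 _ h2' _ h1')).trans ?_
    exact mul_le_mul_of_nonneg_left (le_abs_self _) hε.le
  have hzero := (hdiff.trans_isBigO (hsize.isBigO_one ℝ)).tendsto_zero_of_tendsto
    tendsto_const_nhds
  exact ⟨_, by simpa using hzero.add hform⟩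

end LatentGeometry

/-- Proposition i.  Assume (A1), (A4) and (A5).  If `η` is a curve
in `Z`, then `γ_t := φ(η_t)` is a curve in `M = φ(Z)`. -/
theorem curve_image_in_M {d dt : ℕ} (G : LatentGeometry d dt)
    (η η' : ℝ → EuclideanSpace ℝ (Fin dt))
    (hη : IsCurveIn G.Zset η η') :
    ∃ γ' : ℝ → lp (fun _ : ℕ => ℝ) 2,
      IsCurveIn (G.phi '' G.Zset) (fun t => G.phi (η t)) γ' := by
  have h : ∀ t, ∃ v, t ∈ Icc (0 : ℝ) 1 → Filter.Tendsto
      (fun p : ℝ × ℝ => slope (fun x => G.phi (η x)) p.1 p.2) (pairFilter (Icc 0 1) t)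
      (nhds v) := by
    intro t
    by_cases ht : t ∈ Icc (0 : ℝ) 1
    · have := pairFilter_neBot ht
      obtain ⟨c, hc⟩ := G.tendsto_inner_slope hη ht
      obtain ⟨v, hv⟩ := exists_tendsto_of_tendsto_inner
        (q := fun p : ℝ × ℝ => slope (fun x => G.phi (η x)) p.1 p.2) hc
      exact ⟨v, fun _ => hv⟩
    · exact ⟨0, fun h => absurd h ht⟩
  choose γ' hγ' using h
  exact ⟨γ', isCurveIn_of_tendsto_slope (fun t ht => mem_image_of_mem _ (hη.1 t ht)) hγ'⟩
end
end

section
/- Assume (A1), (A4) and (A5). If γ is a curve in M, then η : [0,1] → Z defined by η_t := φ^{-1}(γ_t) is a curve in Z. -/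
open Set
open scoped RealInnerProductSpace

noncomputable section

/-- A function on a box whose partial derivatives are bounded by `C` is Lipschitz on the box. -/
theorem abs_sub_le_of_partial_deriv_le {n : ℕ} {S : Fin n → Set ℝ} (hS : ∀ i, Convex ℝ (S i))
    {p : EuclideanSpace ℝ (Fin n) → ℝ} {C : ℝ}
    (hp : ∀ z : EuclideanSpace ℝ (Fin n), (∀ i, z i ∈ S i) → ∀ j, ∃ c, |c| ≤ C ∧
      HasDerivAt (fun t : ℝ => p (z + t • EuclideanSpace.single j (1 : ℝ))) c 0)
    {z w : EuclideanSpace ℝ (Fin n)} (hz : ∀ i, z i ∈ S i) (hw : ∀ i, w i ∈ S i) :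
    |p z - p w| ≤ n * C * ‖z - w‖ := by
  have coord : ∀ (j : Fin n) (r : ℝ) (w : EuclideanSpace ℝ (Fin n)), (∀ i, w i ∈ S i) → r ∈ S j →
      |p (w + (r - w j) • EuclideanSpace.single j (1 : ℝ)) - p w| ≤ C * |r - w j| := by
    intro j r w hw hr
    have mem : ∀ t ∈ S j, ∀ i, (w + (t - w j) • EuclideanSpace.single j (1 : ℝ)) i ∈ S i := by
      intro t ht i
      rcases eq_or_ne i j with rfl | hij
      · simpa using ht
      · simpa [hij] using hw i
    choose! c hc hcd using fun t ht => hp _ (mem t ht) j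
    have key := (hS j).norm_image_sub_le_of_norm_hasDerivWithin_le
      (f := fun t => p (w + (t - w j) • EuclideanSpace.single j (1 : ℝ))) (f' := c) (C := C)
      (fun t ht => ?_) (fun t ht => hc t ht) (hw j) hr
    · simpa using key
    · have h := hcd t ht
      rw [← sub_self t] at h
      refine ((h.comp_sub_const t t).congr_of_eventuallyEq (.of_forall fun s => ?_)).hasDerivWithinAt
      simp only [add_assoc, ← add_smul]
      congr 3
      ring
  have main : ∀ (s : Finset (Fin n)) (w : EuclideanSpace ℝ (Fin n)), (∀ i, w i ∈ S i) →
      (∀ i ∉ s, z i = w i) → |p z - p w| ≤ ∑ j ∈ s, C * |z j - w j| := by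
    intro s
    induction s using Finset.induction_on with
    | empty =>
      intro w _ h
      have : z = w := by ext i; exact h i (by simp)
      simp [this]
    | insert a s ha ih =>
      intro w hw h
      set w' := w + (z a - w a) • EuclideanSpace.single a (1 : ℝ) with hw'
      have hne : ∀ i, i ≠ a → w' i = w i := fun i hi => by simp [hw', hi]
      have heq : w' a = z a := by simp [hw']
      have h1 := ih w' (fun i => by
          rcases eq_or_ne i a with rfl | hi
          · rw [heq]; exact hz i
          · rw [hne i hi]; exact hw i) (fun i hi => by
          rcases eq_or_ne i a with rfl | hia
          · exact heq.symm
          · rw [hne i hia]; exact h i (by simp [hia, hi]))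
      have h2 := coord a (z a) w hw (hz a)
      rw [Finset.sum_insert ha]
      have h3 : ∑ j ∈ s, C * |z j - w' j| = ∑ j ∈ s, C * |z j - w j| :=
        Finset.sum_congr rfl fun j hj => by rw [hne j (fun e => ha (e ▸ hj))]
      rw [h3] at h1
      calc |p z - p w| ≤ |p z - p w'| + |p w' - p w| := abs_sub_le _ _ _
        _ ≤ _ := by linarith
  refine (main Finset.univ w hw (by simp)).trans ?_
  calc ∑ j, C * |z j - w j| ≤ ∑ _j : Fin n, C * ‖z - w‖ := by
        refine Finset.sum_le_sum fun j _ => ?_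
        obtain ⟨c, hc, _⟩ := hp z hz j
        exact mul_le_mul_of_nonneg_left (PiLp.norm_apply_le (z - w) j)
          ((abs_nonneg c).trans hc)
    _ = n * C * ‖z - w‖ := by simp [mul_assoc]

/-- A positive-definite matrix is coercive. -/
theorem Matrix.PosDef.exists_pos_le_inner {n : ℕ} {A : Matrix (Fin n) (Fin n) ℝ} (hA : A.PosDef) :
    ∃ c > 0, ∀ u : EuclideanSpace ℝ (Fin n),
      c * ‖u‖ ^ 2 ≤ ⟪u, Matrix.toEuclideanCLM (𝕜 := ℝ) A u⟫ := by
  set T := Matrix.toEuclideanCLM (𝕜 := ℝ) A with hT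
  have pos : ∀ u : EuclideanSpace ℝ (Fin n), u ≠ 0 → 0 < ⟪u, T u⟫ := by
    intro u hu
    have := hA.dotProduct_mulVec_pos (x := u.ofLp) (by simpa using hu)
    rw [EuclideanSpace.inner_eq_star_dotProduct, hT, Matrix.ofLp_toEuclideanCLM, dotProduct_comm]
    simpa using this
  rcases (Metric.sphere (0 : EuclideanSpace ℝ (Fin n)) 1).eq_empty_or_nonempty with he | hne
  · refine ⟨1, one_pos, fun u => ?_⟩
    have : u = 0 := by
      by_contra hu
      have : ‖u‖⁻¹ • u ∈ Metric.sphere (0 : EuclideanSpace ℝ (Fin n)) 1 := by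
        simp [norm_smul, hu]
      simp [he] at this
    simp [this]
  · obtain ⟨v, hv, hmin⟩ := (isCompact_sphere (0 : EuclideanSpace ℝ (Fin n)) 1).exists_isMinOn hne
      (f := fun u => ⟪u, T u⟫) (by fun_prop)
    have hv0 : v ≠ 0 := by rintro rfl; simp at hv
    refine ⟨⟪v, T v⟫, pos v hv0, fun u => ?_⟩
    rcases eq_or_ne u 0 with rfl | hu
    · simp
    have hu' : ‖u‖⁻¹ • u ∈ Metric.sphere (0 : EuclideanSpace ℝ (Fin n)) 1 := by
      simp [norm_smul, hu]
    have h : ⟪v, T v⟫ ≤ ⟪‖u‖⁻¹ • u, T (‖u‖⁻¹ • u)⟫ := hmin hu'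
    rw [map_smul, real_inner_smul_left, real_inner_smul_right] at h
    have hn : 0 < ‖u‖ := norm_pos_iff.mpr hu
    calc ⟪v, T v⟫ * ‖u‖ ^ 2 ≤ (‖u‖⁻¹ * (‖u‖⁻¹ * ⟪u, T u⟫)) * ‖u‖ ^ 2 := by gcongr
      _ = ⟪u, T u⟫ := by field_simp

/-- If the Gram matrices of a convergent family `D` are asymptotically those of a family `u`
with respect to a coercive form, then `u` converges. -/
theorem exists_tendsto_of_gram_approx {α E H : Type*} [NormedAddCommGroup E]
    [InnerProductSpace ℝ E] [CompleteSpace E] [NormedAddCommGroup H] [InnerProductSpace ℝ H]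
    {l : Filter α} [l.NeBot] {u : α → E} {D : α → H} {T : E →L[ℝ] E} {c : ℝ} (hc : 0 < c)
    (hT : ∀ v, c * ‖v‖ ^ 2 ≤ ⟪v, T v⟫) {a : H} (hD : Filter.Tendsto D l (nhds a))
    (hu : ∀ ε > 0, ∃ S ∈ l, ∀ p ∈ S, ∀ q ∈ S,
      |⟪D p, D q⟫ - ⟪u p, T (u q)⟫| ≤ ε * ‖u p‖ * ‖u q‖) :
    ∃ v, Filter.Tendsto u l (nhds v) := by
  obtain ⟨K, hK0, S₁, hS₁, hK⟩ : ∃ K > 0, ∃ S ∈ l, ∀ p ∈ S, ‖u p‖ ^ 2 ≤ K := by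
    obtain ⟨S, hS, h⟩ := hu (c / 2) (by positivity)
    refine ⟨2 / c * (‖a‖ + 1) ^ 2, by positivity, _,
      Filter.inter_mem hS (hD.norm.eventually_lt_const (lt_add_one ‖a‖)), fun p hp => ?_⟩
    have h1 := (abs_le.mp (h p hp.1 p hp.1)).1
    have h2 := hT (u p)
    have h3 : ‖D p‖ ^ 2 ≤ (‖a‖ + 1) ^ 2 := by
      have : ‖D p‖ < ‖a‖ + 1 := hp.2
      gcongr
    rw [real_inner_self_eq_norm_sq] at h1
    have h4 : c / 2 * ‖u p‖ ^ 2 ≤ (‖a‖ + 1) ^ 2 := by nlinarith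
    calc ‖u p‖ ^ 2 = 2 / c * (c / 2 * ‖u p‖ ^ 2) := by field_simp
      _ ≤ _ := by gcongr
  refine CompleteSpace.complete (f := l.map u) (Metric.cauchy_iff.mpr ⟨inferInstance, fun ε hε => ?_⟩)
  obtain ⟨S₂, hS₂, h⟩ := hu (c * ε ^ 2 / (8 * K)) (by positivity)
  obtain ⟨A, hA, hAd⟩ := (Metric.cauchy_iff.mp hD.cauchy_map).2 (Real.sqrt (c * ε ^ 2 / 2))
    (by positivity)
  refine ⟨u '' (S₁ ∩ S₂ ∩ D ⁻¹' A), Filter.image_mem_map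
    (Filter.inter_mem (Filter.inter_mem hS₁ hS₂) hA), ?_⟩
  rintro _ ⟨p, ⟨⟨hp1, hp2⟩, hpA⟩, rfl⟩ _ ⟨q, ⟨⟨hq1, hq2⟩, hqA⟩, rfl⟩
  have hd : ‖D p - D q‖ ^ 2 < c * ε ^ 2 / 2 := by
    have := hAd _ hpA _ hqA
    rw [dist_eq_norm] at this
    exact (Real.lt_sqrt (norm_nonneg _)).mp this
  have e1 := (abs_le.mp (h p hp2 p hp2)).1
  have e2 := (abs_le.mp (h p hp2 q hq2)).2
  have e3 := (abs_le.mp (h q hq2 p hp2)).2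
  have e4 := (abs_le.mp (h q hq2 q hq2)).1
  have e5 := hT (u p - u q)
  have e6 : (c * ε ^ 2 / (8 * K)) * (‖u p‖ + ‖u q‖) ^ 2 ≤ c * ε ^ 2 / 2 := by
    have : (‖u p‖ + ‖u q‖) ^ 2 ≤ 4 * K := by
      nlinarith [sq_nonneg (‖u p‖ - ‖u q‖), hK p hp1, hK q hq1]
    calc _ ≤ (c * ε ^ 2 / (8 * K)) * (4 * K) := by gcongr
      _ = _ := by field_simp; norm_num
  rw [← real_inner_self_eq_norm_sq] at hd
  simp only [map_sub, inner_sub_left, inner_sub_right] at e5 hd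
  have e7 : c * ‖u p - u q‖ ^ 2 < c * ε ^ 2 := by nlinarith
  rw [dist_eq_norm]
  exact lt_of_pow_lt_pow_left₀ 2 hε.le (lt_of_mul_lt_mul_left e7 hc.le)

/-- A difference quotient of a `C¹` function on a convex set converges jointly in both
arguments. -/
theorem tendsto_slope_of_continuousWithinAt_deriv {H : Type*} [NormedAddCommGroup H]
    [NormedSpace ℝ H] {s : Set ℝ} (hs : Convex ℝ s) {γ γ' : ℝ → H}
    (hγ : ∀ t ∈ s, HasDerivWithinAt γ (γ' t) s t) {a : ℝ} (hγ' : ContinuousWithinAt γ' s a) :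
    Filter.Tendsto (fun p : ℝ × ℝ => slope γ p.1 p.2)
      (nhdsWithin (a, a) {p | p.1 ∈ s ∧ p.2 ∈ s ∧ p.1 ≠ p.2}) (nhds (γ' a)) := by
  rw [Metric.tendsto_nhdsWithin_nhds]
  intro ε hε
  obtain ⟨δ, hδ, h⟩ := Metric.continuousWithinAt_iff.mp hγ' (ε / 2) (by positivity)
  refine ⟨δ, hδ, ?_⟩
  rintro ⟨x, y⟩ ⟨hx, hy, hxy⟩ hd
  simp only at hx hy hxy
  rw [Prod.dist_eq, max_lt_iff] at hd
  have key := (hs.inter (convex_ball a δ)).norm_image_sub_le_of_norm_hasDerivWithin_le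
    (f := fun t => γ t - t • γ' a) (f' := fun t => γ' t - (1 : ℝ) • γ' a) (C := ε / 2)
    (fun t ht => ((hγ t ht.1).mono inter_subset_left).sub
      ((hasDerivWithinAt_id t _).smul_const (γ' a)))
    (fun t ht => by
      have := h ht.1 ht.2
      rw [dist_eq_norm] at this
      simpa using this.le) ⟨hx, hd.1⟩ ⟨hy, hd.2⟩
  have hne : y - x ≠ 0 := sub_ne_zero.mpr (Ne.symm hxy)
  have e : slope γ x y - γ' a = (y - x)⁻¹ • ((γ y - y • γ' a) - (γ x - x • γ' a)) := by
    rw [slope_def_module, show (γ y - y • γ' a) - (γ x - x • γ' a)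
      = (γ y - γ x) - (y - x) • γ' a by rw [sub_smul]; abel, smul_sub _ (γ y - γ x),
      inv_smul_smul₀ hne]
  have hpos : 0 < ‖y - x‖ := norm_pos_iff.mpr hne
  rw [dist_eq_norm, e, norm_smul, norm_inv]
  calc ‖y - x‖⁻¹ * _ ≤ ‖y - x‖⁻¹ * (ε / 2 * ‖y - x‖) := by gcongr
    _ = ε / 2 := by field_simp
    _ < ε := by linarith

/-- If the difference quotients of `η` converge jointly in both arguments at every point of `s`,
then `η` is continuously differentiable on `s`. -/
theorem exists_hasDerivWithinAt_continuousOn_of_tendsto_slope {E : Type*} [NormedAddCommGroup E]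
    [NormedSpace ℝ E] {s : Set ℝ} (hs : UniqueDiffOn ℝ s) {η : ℝ → E}
    (h : ∀ a ∈ s, ∃ v, Filter.Tendsto (fun p : ℝ × ℝ => slope η p.1 p.2)
      (nhdsWithin (a, a) {p | p.1 ∈ s ∧ p.2 ∈ s ∧ p.1 ≠ p.2}) (nhds v)) :
    ∃ η' : ℝ → E, (∀ t ∈ s, HasDerivWithinAt η (η' t) s t) ∧ ContinuousOn η' s := by
  choose! η' hη' using h
  have hderiv : ∀ t ∈ s, HasDerivWithinAt η (η' t) s t := by
    intro t ht
    rw [hasDerivWithinAt_iff_tendsto_slope]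
    refine (hη' t ht).comp (f := fun y => (t, y)) (tendsto_nhdsWithin_iff.mpr ⟨?_, ?_⟩)
    · exact (Continuous.tendsto (by fun_prop) t).mono_left nhdsWithin_le_nhds
    · filter_upwards [self_mem_nhdsWithin] with y hy
      exact ⟨ht, hy.1, fun e => hy.2 e.symm⟩
  refine ⟨η', hderiv, fun a ha => Metric.continuousWithinAt_iff.mpr fun ε hε => ?_⟩
  obtain ⟨δ, hδ, h⟩ := Metric.tendsto_nhdsWithin_nhds.mp (hη' a ha) (ε / 2) (by positivity)
  refine ⟨δ, hδ, fun {x} hx hxd => lt_of_le_of_lt ?_ (half_lt_self hε)⟩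
  have : (nhdsWithin x (s \ {x})).NeBot := by
    have := (hs x hx).accPt
    rwa [accPt_principal_iff_nhdsWithin] at this
  refine le_of_tendsto ((hasDerivWithinAt_iff_tendsto_slope.mp (hderiv x hx)).dist
    tendsto_const_nhds) ?_
  filter_upwards [self_mem_nhdsWithin,
    mem_nhdsWithin_of_mem_nhds (Metric.isOpen_ball.mem_nhds hxd)] with y hy hyd
  refine (h (x := (x, y)) ⟨hx, hy.1, fun e => hy.2 e.symm⟩ ?_).le
  rw [Prod.dist_eq]
  exact max_lt hxd hyd

namespace LatentGeometry

variable {d dt : ℕ} (G : LatentGeometry d dt)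

theorem inner_eq {x y : EuclideanSpace ℝ (Fin dt)} (hx : x ∈ G.Zset) (hy : y ∈ G.Zset) :
    ⟪G.phi x, G.phi y⟫ = G.F x y := by
  rw [G.F_eq x hx y hy, G.kernel_eq x hx y hy]

theorem injOn_phi : InjOn G.phi G.Zset := by
  intro x hx y hy h
  by_contra hne
  obtain ⟨ξ, hξ, hf⟩ := G.distinguish x hx y hy hne
  exact hf (by rw [G.kernel_eq x hx ξ hξ, G.kernel_eq y hy ξ hξ, h])

theorem continuousOn_phi : ContinuousOn G.phi G.Zset := by
  intro x hx
  rw [ContinuousWithinAt, tendsto_iff_norm_sub_tendsto_zero]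
  have hdiag : Filter.Tendsto (fun y => G.f y y) (nhdsWithin x G.Zset) (nhds (G.f x x)) :=
    (G.contf (x, x) ⟨hx, hx⟩).comp (f := fun y => (y, y)) (s := G.Zset)
      (by fun_prop) (fun y hy => ⟨hy, hy⟩)
  have hrow : Filter.Tendsto (fun y => G.f y x) (nhdsWithin x G.Zset) (nhds (G.f x x)) :=
    (G.contf (x, x) ⟨hx, hx⟩).comp (f := fun y => (y, x)) (s := G.Zset)
      (by fun_prop) (fun y hy => ⟨hy, hx⟩)
  have h0 : Filter.Tendsto (fun y => Real.sqrt (G.f y y - 2 * G.f y x + G.f x x))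
      (nhdsWithin x G.Zset) (nhds 0) := by
    have := (((hdiag.sub (hrow.const_mul 2)).add_const (G.f x x))).sqrt
    rwa [show G.f x x - 2 * G.f x x + G.f x x = 0 by ring, Real.sqrt_zero] at this
  refine h0.congr' ?_
  filter_upwards [self_mem_nhdsWithin] with y hy
  rw [G.kernel_eq y hy y hy, G.kernel_eq y hy x hx, G.kernel_eq x hx x hx,
    real_inner_self_eq_norm_sq, real_inner_self_eq_norm_sq, ← norm_sub_sq_real,
    Real.sqrt_sq (norm_nonneg _)]

/-- `φ` is a homeomorphism onto its image, so continuity can be checked after composing with it. -/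
theorem continuousOn_of_phi_comp {X : Type*} [TopologicalSpace X] {s : Set X}
    {η : X → EuclideanSpace ℝ (Fin dt)} (hη : MapsTo η s G.Zset)
    (h : ContinuousOn (fun t => G.phi (η t)) s) : ContinuousOn η s := by
  have : CompactSpace G.Zset := isCompact_iff_compactSpace.mp G.compact
  have emb : Topology.IsClosedEmbedding (G.Zset.domRestrict G.phi) :=
    (continuousOn_iff_continuous_domRestrict.mp G.continuousOn_phi).isClosedEmbedding
      (injOn_iff_injective.mp G.injOn_phi)
  have hc : Continuous (hη.restrict η s G.Zset) :=
    emb.isEmbedding.continuous_iff.mpr (continuousOn_iff_continuous_domRestrict.mp h)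
  exact continuousOn_iff_continuous_domRestrict.mpr (continuous_subtype_val.comp hc)

/-- Second differences of the kernel are approximated by the form of the matrix `H_ξ`. -/
theorem exists_nhds_second_difference_le {ξ : EuclideanSpace ℝ (Fin dt)} (hξ : ξ ∈ G.Zset)
    {ε : ℝ} (hε : 0 < ε) :
    ∃ U ∈ nhds ξ, ∀ x ∈ U, ∀ y ∈ U, ∀ z ∈ U, ∀ w ∈ U,
      |(G.F x z - G.F y z - (G.F x w - G.F y w))
        - ⟪x - y, Matrix.toEuclideanCLM (𝕜 := ℝ) (G.Hm ξ ξ) (z - w)⟫|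
        ≤ ε * ‖x - y‖ * ‖z - w‖ := by
  set T := Matrix.toEuclideanCLM (𝕜 := ℝ) (G.Hm ξ ξ) with hT
  have hTe : ∀ i j, ⟪EuclideanSpace.single i (1 : ℝ), T (EuclideanSpace.single j (1 : ℝ))⟫
      = G.Hm ξ ξ i j := by
    intro i j
    simp [hT, EuclideanSpace.inner_single_left, Matrix.ofLp_toEuclideanCLM]
  set ε' := ε / ((dt : ℝ) ^ 2 + 1) with hε'
  have hε'pos : 0 < ε' := by positivity
  obtain ⟨U', hU', hclose⟩ : ∃ U' ∈ nhds ξ, ∀ z ∈ U', ∀ z' ∈ U', z ∈ G.Zt ∧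
      ∀ i j, |G.Hm z z' i j - G.Hm ξ ξ i j| ≤ ε' := by
    have hZ : G.Zt ∈ nhds ξ := G.Zt_open.mem_nhds (G.subset_Zt hξ)
    have h1 : ∀ i j, ∀ᶠ p in nhds ξ ×ˢ nhds ξ, |G.Hm p.1 p.2 i j - G.Hm ξ ξ i j| ≤ ε' := by
      intro i j
      have := (G.Hm_cont i j).continuousAt (x := (ξ, ξ)) (prod_mem_nhds hZ hZ)
      rw [← nhds_prod_eq]
      filter_upwards [this (Metric.closedBall_mem_nhds _ hε'pos)] with p hp
      simpa [Real.dist_eq] using hp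
    obtain ⟨V, hV, h2⟩ := Filter.eventually_prod_self_iff'.mp
      (Filter.eventually_all.mpr fun i => Filter.eventually_all.mpr fun j => h1 i j)
    exact ⟨V ∩ G.Zt, Filter.inter_mem hV hZ, fun z hz z' hz' => ⟨hz.2, h2 z hz.1 z' hz'.1⟩⟩
  have hpre : WithLp.toLp 2 ⁻¹' U' ∈ nhds ξ.ofLp :=
    (PiLp.continuous_toLp 2 (fun _ : Fin dt => ℝ)).continuousAt hU'
  obtain ⟨δ, hδ, hball⟩ := Metric.mem_nhds_iff.mp hpre
  set S : Fin dt → Set ℝ := fun i => Metric.ball (ξ i) δ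
  have hS : ∀ i, Convex ℝ (S i) := fun i => convex_ball _ _
  have hSU : ∀ z : EuclideanSpace ℝ (Fin dt), (∀ i, z i ∈ S i) → z ∈ U' := fun z hz =>
    hball (show z.ofLp ∈ Metric.ball ξ.ofLp δ from (dist_pi_lt_iff hδ).mpr hz)
  have hSnhds : {z : EuclideanSpace ℝ (Fin dt) | ∀ i, z i ∈ S i} ∈ nhds ξ := by
    refine Filter.eventually_all.mpr fun i => ?_
    have hc : Continuous fun z : EuclideanSpace ℝ (Fin dt) => z i := by fun_prop
    exact hc.continuousAt (Metric.ball_mem_nhds (ξ i) hδ)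
  refine ⟨_, hSnhds, fun x hx y hy z hz w hw => ?_⟩
  have line : ∀ u v e : EuclideanSpace ℝ (Fin dt),
      HasDerivAt (fun t : ℝ => ⟪u, T (v + t • e)⟫) ⟪u, T e⟫ 0 := by
    intro u v e
    simp only [map_add, map_smul, inner_add_right, real_inner_smul_right]
    simpa using ((hasDerivAt_id (0 : ℝ)).mul_const ⟪u, T e⟫).const_add ⟪u, T v⟫
  have line' : ∀ u v e : EuclideanSpace ℝ (Fin dt),
      HasDerivAt (fun t : ℝ => ⟪v + t • e, u⟫) ⟪e, u⟫ 0 := by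
    intro u v e
    simp only [inner_add_left, real_inner_smul_left]
    simpa using ((hasDerivAt_id (0 : ℝ)).mul_const ⟪e, u⟫).const_add ⟪v, u⟫
  have hfirst : ∀ z' : EuclideanSpace ℝ (Fin dt), (∀ i, z' i ∈ S i) → ∀ j,
      |G.g1 x z' j - G.g1 y z' j - ⟪x - y, T (EuclideanSpace.single j (1 : ℝ))⟫|
        ≤ dt * ε' * ‖x - y‖ := by
    intro z' hz' j
    have := abs_sub_le_of_partial_deriv_le hS
      (p := fun v => G.g1 v z' j - ⟪v, T (EuclideanSpace.single j (1 : ℝ))⟫) (C := ε')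
      (fun v hv i => ⟨G.Hm v z' i j - G.Hm ξ ξ i j,
        (hclose v (hSU v hv) z' (hSU z' hz')).2 i j, by
          rw [← hTe i j]
          exact (G.hHm i j v (hclose v (hSU v hv) v (hSU v hv)).1 z'
            (hclose z' (hSU z' hz') z' (hSU z' hz')).1).sub (line' _ _ _)⟩) hx hy
    rw [inner_sub_left]
    convert this using 2
    ring
  have hsecond := abs_sub_le_of_partial_deriv_le hS
    (p := fun v => G.F x v - G.F y v - ⟪x - y, T v⟫) (C := dt * ε' * ‖x - y‖)
    (fun v hv j => ⟨_, hfirst v hv j, by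
      have hmem : ∀ u : EuclideanSpace ℝ (Fin dt), (∀ i, u i ∈ S i) → u ∈ G.Zt :=
        fun u hu => (hclose u (hSU u hu) u (hSU u hu)).1
      exact ((G.hg1 j x (hmem x hx) v (hmem v hv)).sub
        (G.hg1 j y (hmem y hy) v (hmem v hv))).sub (line _ _ _)⟩) hz hw
  have hle : dt * (dt * ε') ≤ ε := by
    calc dt * (dt * ε') = (dt : ℝ) ^ 2 * ε' := by ring
      _ ≤ ((dt : ℝ) ^ 2 + 1) * ε' := by gcongr; linarith
      _ = ε := by rw [hε']; field_simp
  calc _ = |G.F x z - G.F y z - ⟪x - y, T z⟫ - (G.F x w - G.F y w - ⟪x - y, T w⟫)| := by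
        rw [map_sub, inner_sub_right]
        congr 1
        ring
    _ ≤ dt * (dt * ε' * ‖x - y‖) * ‖z - w‖ := hsecond
    _ = dt * (dt * ε') * ‖x - y‖ * ‖z - w‖ := by ring
    _ ≤ ε * ‖x - y‖ * ‖z - w‖ := by gcongr

end LatentGeometry

/-- Proposition ii.  Assume (A1), (A4) and (A5).  If `γ` is a curve
in `M = φ(Z)`, then `η_t := φ⁻¹(γ_t)` is a curve in `Z`.  (Here `η` is characterised by
`η_t ∈ Z` and `φ(η_t) = γ_t`, which determines it uniquely since `φ` is injective on `Z`
under (A4).) -/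
theorem curve_preimage_in_Z {d dt : ℕ} (G : LatentGeometry d dt)
    (γ γ' : ℝ → lp (fun _ : ℕ => ℝ) 2)
    (hγ : IsCurveIn (G.phi '' G.Zset) γ γ')
    (η : ℝ → EuclideanSpace ℝ (Fin dt))
    (hη : ∀ t ∈ Set.Icc (0:ℝ) 1, η t ∈ G.Zset ∧ G.phi (η t) = γ t) :
    ∃ η' : ℝ → EuclideanSpace ℝ (Fin dt), IsCurveIn G.Zset η η' := by
  obtain ⟨-, hγc, hγd, hγ'c⟩ := hγ
  set I := Icc (0 : ℝ) 1
  have hηc : ContinuousOn η I := G.continuousOn_of_phi_comp (fun t ht => (hη t ht).1)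
    (hγc.congr fun t ht => (hη t ht).2)
  have hI : UniqueDiffOn ℝ I := uniqueDiffOn_Icc one_pos
  suffices h : ∀ a ∈ I, ∃ v, Filter.Tendsto (fun p : ℝ × ℝ => slope η p.1 p.2)
      (nhdsWithin (a, a) {p | p.1 ∈ I ∧ p.2 ∈ I ∧ p.1 ≠ p.2}) (nhds v) by
    obtain ⟨η', hd, hc⟩ := exists_hasDerivWithinAt_continuousOn_of_tendsto_slope hI h
    exact ⟨η', fun t ht => (hη t ht).1, hηc, hd, hc⟩
  intro a ha
  have hne : (nhdsWithin (a, a) {p : ℝ × ℝ | p.1 ∈ I ∧ p.2 ∈ I ∧ p.1 ≠ p.2}).NeBot := by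
    have hacc := (hI a ha).accPt
    rw [accPt_principal_iff_nhdsWithin] at hacc
    refine Filter.Tendsto.neBot (f := fun y => (a, y)) (x := nhdsWithin a (I \ {a}))
      (tendsto_nhdsWithin_iff.mpr ⟨?_, ?_⟩)
    · exact (Continuous.tendsto (by fun_prop) a).mono_left nhdsWithin_le_nhds
    · filter_upwards [self_mem_nhdsWithin] with y hy
      exact ⟨ha, hy.1, fun e => hy.2 e.symm⟩
  obtain ⟨c, hc, hcoer⟩ := (G.Hm_posdef _ (hη a ha).1).exists_pos_le_inner
  refine exists_tendsto_of_gram_approx hc hcoer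
    (tendsto_slope_of_continuousWithinAt_deriv (convex_Icc 0 1) hγd (hγ'c a ha)) fun ε hε => ?_
  obtain ⟨U, hU, happrox⟩ := G.exists_nhds_second_difference_le (hη a ha).1 hε
  obtain ⟨δ, hδ, hball⟩ := Metric.mem_nhdsWithin_iff.mp (hηc a ha hU)
  refine ⟨_, Filter.inter_mem self_mem_nhdsWithin
    (mem_nhdsWithin_of_mem_nhds (Metric.ball_mem_nhds (a, a) hδ)), ?_⟩
  rintro ⟨s, t⟩ ⟨⟨hs, ht, -⟩, hst⟩ ⟨s', t'⟩ ⟨⟨hs', ht', -⟩, hst'⟩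
  simp only at hs ht hs' ht'
  rw [Metric.mem_ball, Prod.dist_eq, max_lt_iff] at hst hst'
  have key := happrox _ (hball ⟨hst.2, ht⟩) _ (hball ⟨hst.1, hs⟩)
    _ (hball ⟨hst'.2, ht'⟩) _ (hball ⟨hst'.1, hs'⟩)
  have hgram : ⟪γ t - γ s, γ t' - γ s'⟫ = G.F (η t) (η t') - G.F (η s) (η t')
      - (G.F (η t) (η s') - G.F (η s) (η s')) := by
    rw [← G.inner_eq (hη t ht).1 (hη t' ht').1, ← G.inner_eq (hη s hs).1 (hη t' ht').1,
      ← G.inner_eq (hη t ht).1 (hη s' hs').1, ← G.inner_eq (hη s hs).1 (hη s' hs').1,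
      (hη t ht).2, (hη s hs).2, (hη t' ht').2, (hη s' hs').2, inner_sub_right, inner_sub_left,
      inner_sub_left]
  rw [← hgram] at key
  simp only [slope_def_module, map_smul, real_inner_smul_left, real_inner_smul_right, norm_smul]
  rw [← mul_sub, ← mul_sub, abs_mul, abs_mul]
  calc _ ≤ |(t' - s')⁻¹| * (|(t - s)⁻¹| * (ε * ‖η t - η s‖ * ‖η t' - η s'‖)) := by gcongr
    _ = _ := by simp only [Real.norm_eq_abs]; ring
end
end

section
/- Assume (A1), (A4) and (A5), and suppose f(z,z') = g(‖z − z'‖²) for all (z,z') in an open neighbourhood of the diagonal D = {(z,z) : z ∈ Z}, where g : [0,∞) → ℝ is twice continuously differentiable. Then H_ξ = −2 g'(0) I_{d̃} for all ξ, positive-definiteness of H_ξ is equivalent to g'(0) < 0, and for any curve η in Z and γ_t := φ(η_t), ∫₀¹ ‖γ̇_t‖₂ dt = √(−2 g'(0)) ∫₀¹ ‖η̇_t‖ dt; i.e. φ is an isometry between Z and M up to the scale factor √(−2g'(0)). -/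
open Set
open scoped RealInnerProductSpace

noncomputable section

/-- Composing `g`, differentiable on `[0, ∞)`, with the squared norm of an affine line. -/
theorem hasDerivAt_comp_norm_sq_line {E : Type*} [NormedAddCommGroup E] [InnerProductSpace ℝ E]
    {g : ℝ → ℝ} {a : ℝ} (w e : E)
    (hg : HasDerivWithinAt g a (Set.Ici (0:ℝ)) (‖w‖ ^ 2)) :
    HasDerivAt (fun t : ℝ => g (‖w + t • e‖ ^ 2)) (a * (2 * ⟪w, e⟫)) 0 := by
  have h1 : HasDerivAt (fun t : ℝ => w + t • e) e 0 := by
    simpa using ((hasDerivAt_id (0:ℝ)).smul_const e).const_add w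
  have h2 : HasDerivAt (fun t : ℝ => ‖w + t • e‖ ^ 2) (2 * ⟪w, e⟫) 0 := by
    simpa using h1.norm_sq
  refine (HasDerivWithinAt.scomp_hasDerivAt_of_eq (s' := Set.Ici (0:ℝ)) (0:ℝ) hg h2 ?_ ?_).congr_deriv
    ?_
  · exact fun t => Set.mem_Ici.2 (sq_nonneg _)
  · simp
  · simp [mul_comm]

/-- If `‖γ s - γ t‖² = 2 g(0) - 2 g(‖η s - η t‖²)` for `s` near `t`, then the speeds of `γ` and `η`
at `t` agree up to the factor `√(-2 g'(0))`. -/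
theorem norm_deriv_eq_of_norm_sub_sq_eq {E F : Type*} [NormedAddCommGroup E] [NormedSpace ℝ E]
    [NormedAddCommGroup F] [NormedSpace ℝ F] {γ : ℝ → E} {γ' : E} {η : ℝ → F} {η' : F}
    {S : Set ℝ} {t : ℝ} (hS : (nhdsWithin t (S \ {t})).NeBot)
    (hγ : HasDerivWithinAt γ γ' S t) (hη : HasDerivWithinAt η η' S t)
    {g : ℝ → ℝ} {c : ℝ} (hg : HasDerivWithinAt g c (Set.Ici (0:ℝ)) 0)
    (h : ∀ᶠ s in nhdsWithin t S,
      ‖γ s - γ t‖ ^ 2 = 2 * g 0 - 2 * g (‖η s - η t‖ ^ 2)) :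
    ‖γ'‖ = Real.sqrt (-2 * c) * ‖η'‖ := by
  have hslope : Filter.Tendsto (Function.update (slope g 0) 0 c)
      (nhdsWithin 0 (Set.Ici (0:ℝ))) (nhds c) := by
    have := (continuousWithinAt_update_same (f := slope g 0) (s := Set.Ici (0:ℝ)) (x := 0)
      (y := c)).2 (hasDerivWithinAt_iff_tendsto_slope.1 hg)
    simpa [ContinuousWithinAt] using this
  have hsub : nhdsWithin t (S \ {t}) ≤ nhdsWithin t S := nhdsWithin_mono _ Set.sdiff_subset
  have hr : Filter.Tendsto (fun s => ‖η s - η t‖ ^ 2) (nhdsWithin t (S \ {t}))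
      (nhdsWithin 0 (Set.Ici (0:ℝ))) := by
    refine tendsto_nhdsWithin_iff.2 ⟨?_, Filter.Eventually.of_forall fun s =>
      Set.mem_Ici.2 (sq_nonneg _)⟩
    have := ((hη.continuousWithinAt.tendsto.mono_left hsub).sub_const (η t)).norm.pow 2
    simpa using this
  have hγs := (hasDerivWithinAt_iff_tendsto_slope.1 hγ).norm.pow 2
  have hηs := ((hasDerivWithinAt_iff_tendsto_slope.1 hη).norm.pow 2).mul
    ((hslope.comp hr).const_mul (-2))
  have heq : ‖γ'‖ ^ 2 = ‖η'‖ ^ 2 * (-2 * c) := by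
    refine tendsto_nhds_unique hγs (hηs.congr' ?_)
    filter_upwards [hsub h] with s hs
    have hfac : ∀ r : ℝ, g r - g 0 = r * Function.update (slope g 0) 0 c r := by
      intro r
      by_cases hr0 : r = 0
      · simp [hr0]
      · rw [Function.update_of_ne hr0, slope_def_field]
        field_simp
        simp
    have hs' : ‖γ s - γ t‖ ^ 2 = ‖η s - η t‖ ^ 2 *
        (-2 * Function.update (slope g 0) 0 c (‖η s - η t‖ ^ 2)) := by
      linear_combination hs - 2 * hfac (‖η s - η t‖ ^ 2)
    simp only [slope, vsub_eq_sub, norm_smul, mul_pow, Function.comp_apply]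
    rw [hs']
    ring
  rw [← Real.sqrt_sq (norm_nonneg γ'), heq, Real.sqrt_mul (sq_nonneg _),
    Real.sqrt_sq (norm_nonneg η'), mul_comm]

/-- A kernel equal to `g(‖z - z'‖²)` near the diagonal has mixed second derivatives
`-2 g'(0) I` on the diagonal. -/
theorem LatentGeometry.Hm_diag_eq {d dt : ℕ} (G : LatentGeometry d dt) {g g1' : ℝ → ℝ} {c : ℝ}
    (hg1 : ∀ x ∈ Set.Ici (0:ℝ), HasDerivWithinAt g (g1' x) (Set.Ici (0:ℝ)) x)
    (hg2 : HasDerivWithinAt g1' c (Set.Ici (0:ℝ)) 0)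
    {N : Set (EuclideanSpace ℝ (Fin dt) × EuclideanSpace ℝ (Fin dt))}
    (hNopen : IsOpen N) (hNsub : N ⊆ G.Zt ×ˢ G.Zt)
    (hfN : ∀ zz ∈ N, G.F zz.1 zz.2 = g (‖zz.1 - zz.2‖ ^ 2))
    {ξ : EuclideanSpace ℝ (Fin dt)} (hξ : (ξ, ξ) ∈ N) :
    G.Hm ξ ξ = (-2 * g1' 0) • (1 : Matrix (Fin dt) (Fin dt) ℝ) := by
  have hgrad : ∀ zz ∈ N, ∀ j, G.g1 zz.1 zz.2 j =
      g1' (‖zz.1 - zz.2‖ ^ 2) * (-2 * (zz.1 - zz.2) j) := by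
    rintro ⟨z, z'⟩ hzz j
    have h1 := G.hg1 j z (hNsub hzz).1 z' (hNsub hzz).2
    have h2 := hasDerivAt_comp_norm_sq_line (z - z') (-EuclideanSpace.single j (1:ℝ))
      (hg1 _ (sq_nonneg ‖z - z'‖))
    have hev : ∀ᶠ t : ℝ in nhds 0, (z, z' + t • EuclideanSpace.single j (1:ℝ)) ∈ N := by
      have hc : Continuous fun t : ℝ => (z, z' + t • EuclideanSpace.single j (1:ℝ)) := by
        fun_prop
      exact hc.continuousAt.eventually_mem (hNopen.mem_nhds (by simpa using hzz))
    have h3 := h1.unique (h2.congr_of_eventuallyEq (by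
      filter_upwards [hev] with t ht
      rw [hfN _ ht]
      congr 3
      simp only [smul_neg]
      abel))
    rw [h3]
    simp only [inner_neg_right, EuclideanSpace.inner_single_right]
    simp
    ring
  ext i j
  have hξt := hNsub hξ
  have h1 := G.hHm i j ξ hξt.1 ξ hξt.2
  have hev : ∀ᶠ t : ℝ in nhds 0, (ξ + t • EuclideanSpace.single i (1:ℝ), ξ) ∈ N := by
    have hc : Continuous fun t : ℝ => (ξ + t • EuclideanSpace.single i (1:ℝ), ξ) := by
      fun_prop
    exact hc.continuousAt.eventually_mem (hNopen.mem_nhds (by simpa using hξ))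
  have h2 : HasDerivAt
      (fun t : ℝ => g1' (‖(0 : EuclideanSpace ℝ (Fin dt)) + t • EuclideanSpace.single i (1:ℝ)‖ ^ 2))
      _ 0 := hasDerivAt_comp_norm_sq_line (a := c) 0 (EuclideanSpace.single i (1:ℝ))
        (by simpa using hg2)
  have h3 : HasDerivAt (fun t : ℝ => t * (-2 * (1 : Matrix (Fin dt) (Fin dt) ℝ) i j))
      (-2 * (1 : Matrix (Fin dt) (Fin dt) ℝ) i j) 0 := by
    simpa using (hasDerivAt_id (0:ℝ)).mul_const (-2 * (1 : Matrix (Fin dt) (Fin dt) ℝ) i j)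
  have h4 := h1.unique ((h2.mul h3).congr_of_eventuallyEq (by
    filter_upwards [hev] with t ht
    rw [hgrad _ ht]
    simp only [add_sub_cancel_left, zero_add, Pi.mul_apply]
    simp [Matrix.one_apply, eq_comm]
    grind))
  rw [h4]
  simp [Matrix.smul_apply]
  ring

/-- squared Euclidean distance kernels.  Assume (A1), (A4), (A5), and
suppose `f(z,z') = g(‖z − z'‖²)` on an open neighbourhood `N` of the diagonal of `Z`,
where `g : [0,∞) → ℝ` is twice continuously differentiable (with first derivative `g1`
and second derivative `g2` on `[0,∞)`).  Then `H_ξ = −2 g'(0) I` for all `ξ ∈ Z`,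
positive-definiteness of `H_ξ` is equivalent to `g'(0) < 0`, and for any curve `η` in `Z`
with image curve `γ = φ ∘ η`, `∫₀¹ ‖γ̇_t‖ dt = √(−2 g'(0)) ∫₀¹ ‖η̇_t‖ dt`;
i.e. `φ` is an isometry between `Z` and `M` up to the scale factor `√(−2 g'(0))`. -/
theorem squared_distance_kernel_isometry {d dt : ℕ} (hd0 : 0 < d)
    (G : LatentGeometry d dt)
    (g g1' g2 : ℝ → ℝ)
    (hg1 : ∀ x ∈ Set.Ici (0:ℝ), HasDerivWithinAt g (g1' x) (Set.Ici (0:ℝ)) x)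
    (hg2 : ∀ x ∈ Set.Ici (0:ℝ), HasDerivWithinAt g1' (g2 x) (Set.Ici (0:ℝ)) x)
    (hg1c : ContinuousOn g1' (Set.Ici (0:ℝ)))
    (hg2c : ContinuousOn g2 (Set.Ici (0:ℝ)))
    (N : Set (EuclideanSpace ℝ (Fin dt) × EuclideanSpace ℝ (Fin dt)))
    (hNopen : IsOpen N) (hNdiag : ∀ z ∈ G.Zset, (z, z) ∈ N)
    (hNsub : N ⊆ G.Zt ×ˢ G.Zt)
    (hfN : ∀ zz ∈ N, G.F zz.1 zz.2 = g (‖zz.1 - zz.2‖ ^ 2)) :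
    (∀ ξ ∈ G.Zset,
        G.Hm ξ ξ = (-2 * g1' 0) • (1 : Matrix (Fin dt) (Fin dt) ℝ)) ∧
    (∀ ξ ∈ G.Zset, ((G.Hm ξ ξ).PosDef ↔ g1' 0 < 0)) ∧
    (∀ (η η' : ℝ → EuclideanSpace ℝ (Fin dt)) (γ γ' : ℝ → lp (fun _ : ℕ => ℝ) 2),
      IsCurveIn G.Zset η η' → IsCurveIn (G.phi '' G.Zset) γ γ' →
      (∀ t ∈ Set.Icc (0:ℝ) 1, γ t = G.phi (η t)) →
      ∫ t in (0:ℝ)..1, ‖γ' t‖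
        = Real.sqrt (-2 * g1' 0) * ∫ t in (0:ℝ)..1, ‖η' t‖) := by
  have hH : ∀ ξ ∈ G.Zset,
      G.Hm ξ ξ = (-2 * g1' 0) • (1 : Matrix (Fin dt) (Fin dt) ℝ) := fun ξ hξ =>
    G.Hm_diag_eq hg1 (hg2 0 Set.self_mem_Ici) hNopen hNsub hfN (hNdiag ξ hξ)
  refine ⟨hH, fun ξ hξ => ?_, ?_⟩
  · have : Nonempty (Fin dt) := ⟨⟨0, hd0.trans_le G.hd⟩⟩
    rw [hH ξ hξ]
    constructor
    · intro h
      have := h.diag_pos (i := Classical.arbitrary (Fin dt))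
      simp at this
      linarith
    · intro h
      exact Matrix.PosDef.one.smul (by linarith)
  · intro η η' γ γ' hη hγ hγη
    rw [← intervalIntegral.integral_const_mul]
    refine intervalIntegral.integral_congr fun t ht => ?_
    rw [Set.uIcc_of_le zero_le_one] at ht
    have hnb : (nhdsWithin t (Set.Icc (0:ℝ) 1 \ {t})).NeBot :=
      accPt_principal_iff_nhdsWithin.1 ((uniqueDiffOn_Icc zero_lt_one) t ht).accPt
    refine norm_deriv_eq_of_norm_sub_sq_eq hnb (hγ.2.2.1 t ht) (hη.2.2.1 t ht)
      (hg1 0 Set.self_mem_Ici) ?_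
    have hcont : ContinuousWithinAt (fun s => (η s, η t)) (Set.Icc (0:ℝ) 1) t :=
      (hη.2.1 t ht).prodMk continuousWithinAt_const
    have hev := hcont.eventually_mem (hNopen.mem_nhds (hNdiag _ (hη.1 t ht)))
    filter_upwards [hev, self_mem_nhdsWithin] with s hs hsI
    have hzs := hη.1 s hsI
    have hzt := hη.1 t ht
    have hdiag : ∀ z ∈ G.Zset, ‖G.phi z‖ ^ 2 = g 0 := by
      intro z hz
      rw [← real_inner_self_eq_norm_sq, ← G.kernel_eq z hz z hz, ← G.F_eq z hz z hz,
        hfN _ (hNdiag z hz)]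
      simp
    rw [hγη s hsI, hγη t ht, norm_sub_sq_real, hdiag _ hzs, hdiag _ hzt,
      ← G.kernel_eq _ hzs _ hzt, ← G.F_eq _ hzs _ hzt, hfN _ hs]
    ring
end
end

section
/- Assume (A1), (A4) and (A5), and suppose f(z,z') = g(z − z') for all (z,z') in an open neighbourhood of the diagonal D = {(z,z) : z ∈ Z}, where g : ℝ^{d̃} → ℝ is twice continuously differentiable. Then H_ξ is constant in ξ and equals the negative Hessian of g at the origin; positive-definiteness of H_ξ for all ξ is equivalent to g having a strict local maximum curvature at the origin (the negative Hessian being positive-definite); and writing W S W^⊤ for the eigendecomposition of this negative Hessian (eigenvalues on the diagonal of S, orthonormal eigenvectors as columns of W), for any curve η in Z and γ_t := φ(η_t), ∫₀¹ ‖γ̇_t‖₂ dt = ∫₀¹ ‖S^{1/2} W^⊤ η̇_t‖ dt. -/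
open Set Matrix
open scoped RealInnerProductSpace

noncomputable section

/-- The negative Hessian of `g : ℝ^{d̃} → ℝ` at the origin, as a matrix. -/
def negHessAtZero {dt : ℕ} (g : EuclideanSpace ℝ (Fin dt) → ℝ) :
    Matrix (Fin dt) (Fin dt) ℝ :=
  Matrix.of fun i j =>
    -(iteratedFDeriv ℝ 2 g 0
        ![EuclideanSpace.single i (1:ℝ), EuclideanSpace.single j (1:ℝ)])

section

open Filter Topology

/-- The symmetric second difference of a twice continuously differentiable function,
`g v + g (-v) - 2 g 0`, agrees with the second derivative at the origin up to `o(‖v‖²)`. -/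
theorem exists_ball_second_difference_le {E : Type*} [NormedAddCommGroup E] [NormedSpace ℝ E]
    {g : E → ℝ} (hg : ContDiff ℝ 2 g) {ε : ℝ} (hε : 0 < ε) :
    ∃ δ > 0, ∀ v : E, ‖v‖ < δ →
      |g v + g (-v) - 2 * g 0 - fderiv ℝ (fderiv ℝ g) 0 v v| ≤ ε * ‖v‖ ^ 2 := by
  set B := fderiv ℝ (fderiv ℝ g) 0
  have hd : Differentiable ℝ g := hg.differentiable (by norm_num)
  have hd2 : HasFDerivAt (fderiv ℝ g) B 0 :=
    ((hg.fderiv_right (m := 1) (by norm_num)).differentiable (by norm_num) 0).hasFDerivAt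
  obtain ⟨δ, hδ, hball⟩ := Metric.eventually_nhds_iff.1
    (hd2.isLittleO.def (half_pos hε))
  have hlin : ∀ x : E, ‖x‖ < δ → ‖fderiv ℝ g x - fderiv ℝ g 0 - B x‖ ≤ ε / 2 * ‖x‖ := by
    intro x hx
    simpa using hball (y := x) (by simpa using hx)
  refine ⟨δ, hδ, fun v hv => ?_⟩
  set p : ℝ → ℝ := fun s => g (s • v) + g (-(s • v)) - 2 * g 0 - s ^ 2 * B v v with hp
  have hline : ∀ s : ℝ, HasDerivAt (fun s : ℝ => s • v) v s := fun s => by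
    simpa using (hasDerivAt_id s).smul_const v
  have hderiv : ∀ s : ℝ, HasDerivAt p
      (fderiv ℝ g (s • v) v + fderiv ℝ g (-(s • v)) (-v) - 2 * s * B v v) s := by
    intro s
    have h1 := (hd (s • v)).hasFDerivAt.comp_hasDerivAt s (hline s)
    have h2 := (hd (-(s • v))).hasFDerivAt.comp_hasDerivAt s (hline s).neg
    have h3 := ((hasDerivAt_pow 2 s).mul_const (B v v))
    refine (((h1.add h2).sub_const (2 * g 0)).sub h3).congr_deriv ?_
    norm_num
  have hbound : ∀ s ∈ Set.Ico (0 : ℝ) 1,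
      ‖fderiv ℝ g (s • v) v + fderiv ℝ g (-(s • v)) (-v) - 2 * s * B v v‖ ≤ ε * ‖v‖ ^ 2 := by
    intro s hs
    have hsv : ‖s • v‖ ≤ ‖v‖ := by
      rw [norm_smul, Real.norm_of_nonneg hs.1]
      exact mul_le_of_le_one_left (norm_nonneg v) hs.2.le
    have key : ∀ x : E, ‖x‖ ≤ ‖v‖ →
        ‖(fderiv ℝ g x - fderiv ℝ g 0 - B x) v‖ ≤ ε / 2 * ‖v‖ ^ 2 := by
      intro x hx
      calc ‖(fderiv ℝ g x - fderiv ℝ g 0 - B x) v‖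
          ≤ ‖fderiv ℝ g x - fderiv ℝ g 0 - B x‖ * ‖v‖ := ContinuousLinearMap.le_opNorm _ _
        _ ≤ (ε / 2 * ‖v‖) * ‖v‖ := by
            gcongr
            exact (hlin x (hx.trans_lt hv)).trans (by gcongr)
        _ = ε / 2 * ‖v‖ ^ 2 := by ring
    have h1 := key (s • v) hsv
    have h2 := key (-(s • v)) (by rwa [norm_neg])
    have hsplit : fderiv ℝ g (s • v) v + fderiv ℝ g (-(s • v)) (-v) - 2 * s * B v v
        = (fderiv ℝ g (s • v) - fderiv ℝ g 0 - B (s • v)) v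
          - (fderiv ℝ g (-(s • v)) - fderiv ℝ g 0 - B (-(s • v))) v := by
      simp
      ring
    rw [hsplit]
    exact (norm_sub_le _ _).trans (by linarith)
  have := norm_image_sub_le_of_norm_deriv_le_segment_01'
    (fun s _ => (hderiv s).hasDerivWithinAt) hbound
  have hp0 : p 0 = 0 := by simp [hp]; ring
  have hp1 : p 1 = g v + g (-v) - 2 * g 0 - B v v := by simp [hp]
  rwa [hp0, sub_zero, hp1, Real.norm_eq_abs] at this

/-- If the squared increments of `γ` are those of a translation invariant kernel `g` evaluated
along `η`, then the squared speed of `γ` is the quadratic form of `-D²g(0)` at the velocity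
of `η`. -/
theorem norm_sq_deriv_eq_neg_fderiv_fderiv {E H : Type*} [NormedAddCommGroup E]
    [NormedSpace ℝ E] [NormedAddCommGroup H] [NormedSpace ℝ H]
    {g : E → ℝ} (hg : ContDiff ℝ 2 g) {s : Set ℝ} {t : ℝ} [(𝓝[s \ {t}] t).NeBot]
    {η : ℝ → E} {η' : E} {γ : ℝ → H} {γ' : H}
    (hη : HasDerivWithinAt η η' s t) (hγ : HasDerivWithinAt γ γ' s t)
    (hinc : ∀ᶠ u in 𝓝[s \ {t}] t,
      ‖γ u - γ t‖ ^ 2 = 2 * g 0 - g (η u - η t) - g (-(η u - η t))) :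
    ‖γ'‖ ^ 2 = -fderiv ℝ (fderiv ℝ g) 0 η' η' := by
  set B := fderiv ℝ (fderiv ℝ g) 0 with hB
  have hη1 := hasDerivWithinAt_iff_tendsto_slope.1 hη
  have hγ2 : Tendsto (fun u => ‖slope γ t u‖ ^ 2) (𝓝[s \ {t}] t) (𝓝 (‖γ'‖ ^ 2)) :=
    (hasDerivWithinAt_iff_tendsto_slope.1 hγ).norm.pow 2
  have hBlim : Tendsto (fun u => B (slope η t u) (slope η t u)) (𝓝[s \ {t}] t)
      (𝓝 (B η' η')) :=
    ((show Continuous fun v => B v v by fun_prop).tendsto η').comp hη1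
  have hsum : Tendsto (fun u => |‖slope γ t u‖ ^ 2 + B (slope η t u) (slope η t u)|)
      (𝓝[s \ {t}] t) (𝓝 |‖γ'‖ ^ 2 + B η' η'|) := (hγ2.add hBlim).abs
  have hle : ∀ ε > 0, |‖γ'‖ ^ 2 + B η' η'| ≤ ε * ‖η'‖ ^ 2 := by
    intro ε hε
    obtain ⟨δ, hδ, hball⟩ := exists_ball_second_difference_le hg hε
    refine le_of_tendsto_of_tendsto hsum ((hη1.norm.pow 2).const_mul ε) ?_
    have hsmall : ∀ᶠ u in 𝓝[s \ {t}] t, ‖η u - η t‖ < δ := by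
      have hc : Tendsto η (𝓝[s \ {t}] t) (𝓝 (η t)) :=
        hη.continuousWithinAt.mono_left (nhdsWithin_mono t Set.sdiff_subset)
      filter_upwards [hc (Metric.ball_mem_nhds _ hδ)] with u hu
      simpa [dist_eq_norm] using hu
    filter_upwards [hsmall, hinc, self_mem_nhdsWithin] with u hu hi hmem
    have hne : u - t ≠ 0 := sub_ne_zero.2 hmem.2
    have hη_eq : η u - η t = (u - t) • slope η t u := by rw [sub_smul_slope]; simp
    have hγ_eq : γ u - γ t = (u - t) • slope γ t u := by rw [sub_smul_slope]; simp
    have h1 := hball _ hu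
    have h2 : g (η u - η t) + g (-(η u - η t)) - 2 * g 0 = -‖γ u - γ t‖ ^ 2 := by
      rw [hi]; ring
    rw [h2, hη_eq, hγ_eq, norm_smul, norm_smul, mul_pow, mul_pow, Real.norm_eq_abs, sq_abs,
      ← hB] at h1
    simp only [map_smul, _root_.smul_apply, smul_eq_mul] at h1
    have hpos : 0 < (u - t) ^ 2 := by positivity
    have h3 : -((u - t) ^ 2 * ‖slope γ t u‖ ^ 2)
          - (u - t) * ((u - t) * B (slope η t u) (slope η t u))
        = -((u - t) ^ 2 * (‖slope γ t u‖ ^ 2 + B (slope η t u) (slope η t u))) := by ring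
    rw [h3, abs_neg, abs_mul, abs_of_pos hpos] at h1
    refine le_of_mul_le_mul_left (h1.trans_eq ?_) hpos
    ring
  have hzero : |‖γ'‖ ^ 2 + B η' η'| ≤ 0 := by
    have hlim : Tendsto (fun ε : ℝ => ε * ‖η'‖ ^ 2) (𝓝[>] 0) (𝓝 0) := by
      have : Tendsto (fun ε : ℝ => ε * ‖η'‖ ^ 2) (𝓝 0) (𝓝 (0 * ‖η'‖ ^ 2)) :=
        tendsto_id.mul_const _
      rw [zero_mul] at this
      exact this.mono_left nhdsWithin_le_nhds
    exact ge_of_tendsto hlim (by filter_upwards [self_mem_nhdsWithin] with ε hε using hle ε hε)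
  have := abs_nonpos_iff.1 hzero
  linarith

theorem negHessAtZero_apply {dt : ℕ} (g : EuclideanSpace ℝ (Fin dt) → ℝ) (i j : Fin dt) :
    negHessAtZero g i j = -fderiv ℝ (fderiv ℝ g) 0
      (EuclideanSpace.single i 1) (EuclideanSpace.single j 1) := by
  simp [negHessAtZero, iteratedFDeriv_two_apply]

theorem dotProduct_negHessAtZero_mulVec {dt : ℕ} (g : EuclideanSpace ℝ (Fin dt) → ℝ)
    (v : EuclideanSpace ℝ (Fin dt)) :
    (fun i => v i) ⬝ᵥ (negHessAtZero g *ᵥ fun i => v i) = -fderiv ℝ (fderiv ℝ g) 0 v v := by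
  have hv : v = ∑ i, v i • EuclideanSpace.single i (1 : ℝ) := by
    ext j
    simp [Finset.sum_apply, Pi.single_apply]
  conv_rhs => rw [hv]
  simp only [map_sum, map_smul, _root_.sum_apply, _root_.smul_apply,
    smul_eq_mul, dotProduct, mulVec, negHessAtZero_apply, Finset.mul_sum, ← Finset.sum_neg_distrib]
  rw [Finset.sum_comm]
  exact Finset.sum_congr rfl fun i _ => Finset.sum_congr rfl fun j _ => by ring

theorem sum_sq_diagonal_sqrt_mul_transpose_mulVec {n : Type*} [Fintype n] [DecidableEq n]
    (W : Matrix n n ℝ) (s : n → ℝ) (hs : ∀ k, 0 ≤ s k) (v : n → ℝ) :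
    ∑ k, ((diagonal (fun k' => Real.sqrt (s k')) * Wᵀ) *ᵥ v) k ^ 2
      = v ⬝ᵥ ((W * diagonal s * Wᵀ) *ᵥ v) := by
  have hW : v ⬝ᵥ (W * diagonal s * Wᵀ) *ᵥ v = (Wᵀ *ᵥ v) ⬝ᵥ (diagonal s *ᵥ (Wᵀ *ᵥ v)) := by
    rw [← mulVec_mulVec, ← mulVec_mulVec, dotProduct_mulVec, ← mulVec_transpose]
  rw [hW, dotProduct, ← mulVec_mulVec]
  refine Finset.sum_congr rfl fun k _ => ?_
  rw [mulVec_diagonal, mulVec_diagonal, mul_pow, Real.sq_sqrt (hs k)]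
  ring

namespace LatentGeometry

variable {d dt : ℕ} (G : LatentGeometry d dt) {g : EuclideanSpace ℝ (Fin dt) → ℝ}
  {N : Set (EuclideanSpace ℝ (Fin dt) × EuclideanSpace ℝ (Fin dt))}

theorem g1_eq_neg_fderiv (hg : ContDiff ℝ 2 g) (hNopen : IsOpen N)
    (hNsub : N ⊆ G.Zt ×ˢ G.Zt) (hfN : ∀ zz ∈ N, G.F zz.1 zz.2 = g (zz.1 - zz.2))
    {z z' : EuclideanSpace ℝ (Fin dt)} (hz : (z, z') ∈ N) (j : Fin dt) :
    G.g1 z z' j = -fderiv ℝ g (z - z') (EuclideanSpace.single j 1) := by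
  set e := EuclideanSpace.single j (1 : ℝ)
  have hline : HasDerivAt (fun t : ℝ => z - (z' + t • e)) (-e) 0 := by
    simpa using (((hasDerivAt_id (0 : ℝ)).smul_const e).const_add z').const_sub z
  have hF : HasFDerivAt g (fderiv ℝ g (z - z')) (z - (z' + (0 : ℝ) • e)) := by
    simpa using (hg.differentiable (by norm_num) (z - z')).hasFDerivAt
  have h := hF.comp_hasDerivAt (0 : ℝ) hline
  have hcont : Continuous fun t : ℝ => (z, z' + t • e) := by fun_prop
  have hev : (fun t : ℝ => G.F z (z' + t • e)) =ᶠ[𝓝 0] (g ∘ fun t : ℝ => z - (z' + t • e)) := by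
    filter_upwards [hcont.continuousAt.preimage_mem_nhds
      (hNopen.mem_nhds (by simpa using hz))] with t ht
    exact hfN _ ht
  have hmem := hNsub hz
  have := (G.hg1 j z hmem.1 z' hmem.2).unique (h.congr_of_eventuallyEq hev)
  rw [this, map_neg]

theorem Hm_eq_negHessAtZero (hg : ContDiff ℝ 2 g) (hNopen : IsOpen N)
    (hNsub : N ⊆ G.Zt ×ˢ G.Zt) (hfN : ∀ zz ∈ N, G.F zz.1 zz.2 = g (zz.1 - zz.2))
    {ξ : EuclideanSpace ℝ (Fin dt)} (hξ : (ξ, ξ) ∈ N) :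
    G.Hm ξ ξ = negHessAtZero g := by
  ext i j
  rw [negHessAtZero_apply]
  set e := EuclideanSpace.single i (1 : ℝ)
  set e' := EuclideanSpace.single j (1 : ℝ)
  have hline : HasDerivAt (fun t : ℝ => ξ + t • e - ξ) e 0 := by
    simpa using (((hasDerivAt_id (0 : ℝ)).smul_const e).const_add ξ).sub_const ξ
  have hF : HasFDerivAt (fderiv ℝ g) (fderiv ℝ (fderiv ℝ g) 0) (ξ + (0 : ℝ) • e - ξ) := by
    simpa using ((hg.fderiv_right (m := 1) (by norm_num)).differentiable
      (by norm_num) 0).hasFDerivAt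
  have h : HasDerivAt (fun t : ℝ => -fderiv ℝ g (ξ + t • e - ξ) e')
      (-fderiv ℝ (fderiv ℝ g) 0 e e') 0 := by
    have h1 := hF.comp_hasDerivAt (0 : ℝ) hline
    have h2 := (h1.clm_apply (hasDerivAt_const (0 : ℝ) e')).neg
    rw [map_zero, add_zero] at h2
    exact h2
  have hcont : Continuous fun t : ℝ => (ξ + t • e, ξ) := by fun_prop
  have hev : (fun t : ℝ => G.g1 (ξ + t • e) ξ j) =ᶠ[𝓝 0]
      fun t : ℝ => -fderiv ℝ g (ξ + t • e - ξ) e' := by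
    filter_upwards [hcont.continuousAt.preimage_mem_nhds
      (hNopen.mem_nhds (by simpa using hξ))] with t ht
    exact G.g1_eq_neg_fderiv hg hNopen hNsub hfN ht j
  have hmem := hNsub hξ
  exact (G.hHm i j ξ hmem.1 ξ hmem.2).unique (h.congr_of_eventuallyEq hev)

theorem norm_sq_phi_sub (hfN : ∀ zz ∈ N, G.F zz.1 zz.2 = g (zz.1 - zz.2))
    (hNdiag : ∀ z ∈ G.Zset, (z, z) ∈ N) {a b : EuclideanSpace ℝ (Fin dt)}
    (ha : a ∈ G.Zset) (hb : b ∈ G.Zset) (hab : (a, b) ∈ N) (hba : (b, a) ∈ N) :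
    ‖G.phi a - G.phi b‖ ^ 2 = 2 * g 0 - g (a - b) - g (-(a - b)) := by
  have hker : ∀ {x y}, x ∈ G.Zset → y ∈ G.Zset → (x, y) ∈ N →
      ⟪G.phi x, G.phi y⟫ = g (x - y) := fun {x y} hx hy hxy => by
    rw [← G.kernel_eq x hx y hy, ← G.F_eq x hx y hy]
    exact hfN (x, y) hxy
  have haa := hker ha ha (hNdiag a ha)
  have hbb := hker hb hb (hNdiag b hb)
  have h1 := hker ha hb hab
  have h2 := hker hb ha hba
  rw [sub_self] at haa hbb
  rw [← real_inner_self_eq_norm_sq, inner_sub_left, inner_sub_right, inner_sub_right,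
    haa, hbb, h1, h2, neg_sub]
  ring

theorem norm_sq_curve_deriv (hg : ContDiff ℝ 2 g) (hNopen : IsOpen N)
    (hNdiag : ∀ z ∈ G.Zset, (z, z) ∈ N) (hfN : ∀ zz ∈ N, G.F zz.1 zz.2 = g (zz.1 - zz.2))
    {η η' : ℝ → EuclideanSpace ℝ (Fin dt)} {γ γ' : ℝ → lp (fun _ : ℕ => ℝ) 2}
    (hη : IsCurveIn G.Zset η η') (hγ : IsCurveIn (G.phi '' G.Zset) γ γ')
    (hγη : ∀ t ∈ Set.Icc (0 : ℝ) 1, γ t = G.phi (η t)) {t : ℝ} (ht : t ∈ Set.Icc (0 : ℝ) 1) :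
    ‖γ' t‖ ^ 2 = -fderiv ℝ (fderiv ℝ g) 0 (η' t) (η' t) := by
  obtain ⟨hηmem, hηcont, hηderiv, -⟩ := hη
  have : (𝓝[Set.Icc (0 : ℝ) 1 \ {t}] t).NeBot :=
    accPt_principal_iff_nhdsWithin.1
      ((uniqueDiffOn_Icc zero_lt_one t ht).accPt)
  refine norm_sq_deriv_eq_neg_fderiv_fderiv hg (hηderiv t ht) (hγ.2.2.1 t ht) ?_
  have hc : Tendsto η (𝓝[Set.Icc (0 : ℝ) 1 \ {t}] t) (𝓝 (η t)) :=
    (hηcont t ht).mono_left (nhdsWithin_mono t Set.sdiff_subset)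
  have hN := hNopen.mem_nhds (hNdiag _ (hηmem t ht))
  filter_upwards [(hc.prodMk_nhds tendsto_const_nhds).eventually hN,
    (tendsto_const_nhds.prodMk_nhds hc).eventually hN, self_mem_nhdsWithin] with u h1 h2 hu
  rw [hγη u hu.1, hγη t ht]
  exact G.norm_sq_phi_sub hfN hNdiag (hηmem u hu.1) (hηmem t ht) h1 h2

end LatentGeometry

end

/-- translation invariant kernels.  Assume (A1), (A4), (A5), and
suppose `f(z,z') = g(z − z')` on an open neighbourhood `N` of the diagonal of `Z`, where
`g : ℝ^{d̃} → ℝ` is twice continuously differentiable.  Then `H_ξ` is constant in `ξ`,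
equal to the negative Hessian of `g` at the origin; positive-definiteness of `H_ξ` for
all `ξ` is equivalent to this negative Hessian being positive-definite; and writing
`W S Wᵀ` for an eigendecomposition of the negative Hessian, for any curve `η` in `Z`
with image curve `γ = φ ∘ η`, `∫₀¹ ‖γ̇_t‖₂ dt = ∫₀¹ ‖S^{1/2} Wᵀ η̇_t‖ dt`. -/
theorem translation_invariant_kernel_geometry {d dt : ℕ}
    (G : LatentGeometry d dt)
    (g : EuclideanSpace ℝ (Fin dt) → ℝ) (hg : ContDiff ℝ 2 g)
    (N : Set (EuclideanSpace ℝ (Fin dt) × EuclideanSpace ℝ (Fin dt)))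
    (hNopen : IsOpen N) (hNdiag : ∀ z ∈ G.Zset, (z, z) ∈ N)
    (hNsub : N ⊆ G.Zt ×ˢ G.Zt)
    (hfN : ∀ zz ∈ N, G.F zz.1 zz.2 = g (zz.1 - zz.2)) :
    (∀ ξ ∈ G.Zset, G.Hm ξ ξ = negHessAtZero g) ∧
    ((∀ ξ ∈ G.Zset, (G.Hm ξ ξ).PosDef) ↔ (negHessAtZero g).PosDef) ∧
    (∀ (W : Matrix (Fin dt) (Fin dt) ℝ) (s : Fin dt → ℝ),
      Wᵀ * W = 1 → W * Wᵀ = 1 → (∀ k, 0 ≤ s k) →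
      negHessAtZero g = W * Matrix.diagonal s * Wᵀ →
      ∀ (η η' : ℝ → EuclideanSpace ℝ (Fin dt)) (γ γ' : ℝ → lp (fun _ : ℕ => ℝ) 2),
        IsCurveIn G.Zset η η' → IsCurveIn (G.phi '' G.Zset) γ γ' →
        (∀ t ∈ Set.Icc (0:ℝ) 1, γ t = G.phi (η t)) →
        ∫ t in (0:ℝ)..1, ‖γ' t‖
          = ∫ t in (0:ℝ)..1,
              Real.sqrt (∑ k,
                ((Matrix.diagonal (fun k' => Real.sqrt (s k')) * Wᵀ).mulVec
                  (fun i => η' t i) k) ^ 2)) := by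
  have hH : ∀ ξ ∈ G.Zset, G.Hm ξ ξ = negHessAtZero g := fun ξ hξ =>
    G.Hm_eq_negHessAtZero hg hNopen hNsub hfN (hNdiag ξ hξ)
  refine ⟨hH, ⟨fun h => ?_, fun h ξ hξ => (hH ξ hξ).symm ▸ h⟩, ?_⟩
  · obtain ⟨ξ, hξ⟩ := G.nonempty
    exact hH ξ hξ ▸ h ξ hξ
  · intro W s _ _ hs hWS η η' γ γ' hη hγ hγη
    refine intervalIntegral.integral_congr fun t ht => ?_
    rw [Set.uIcc_of_le zero_le_one] at ht
    dsimp only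
    rw [sum_sq_diagonal_sqrt_mul_transpose_mulVec W s hs, ← hWS,
      dotProduct_negHessAtZero_mulVec, ← G.norm_sq_curve_deriv hg hNopen hNdiag hfN hη hγ hγη ht,
      Real.sqrt_sq (norm_nonneg _)]
end
end

section
/- Under the Latent Metric Space model with assumptions (A1) and (A3) (rank r), for any ε₁ > 0 and ε₂ ∈ (0, 1/2), on the event A₁(ε₁) ∩ A₂(ε₂) one has ‖U_Y U_Y^⊤ − U_Φ U_Φ^⊤‖₂ ≤ (ε₁ + n^{-1}σ²)/(λ_r^f (1 − 2ε₂)) and ‖U_Φ^⊤ U_Y − F_*‖₂ ≤ [(ε₁ + n^{-1}σ²)/(λ_r^f (1 − 2ε₂))]². -/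
open Matrix

/-- Spectral norm (ℓ²-operator norm) of a real matrix. -/
noncomputable def specNorm {m n : ℕ} (A : Matrix (Fin m) (Fin n) ℝ) : ℝ :=
  ‖LinearMap.toContinuousLinearMap (Matrix.toEuclideanLin A)‖

/-- The matrix made of the first `r` columns of an `n × n` matrix. -/
def firstCols {n r : ℕ} (h : r ≤ n) (O : Matrix (Fin n) (Fin n) ℝ) :
    Matrix (Fin n) (Fin r) ℝ :=
  Matrix.of fun i k => O i (Fin.castLE h k)

section L2Operator

open scoped Matrix.Norms.L2Operator

theorem sq_norm_toLp {m : ℕ} (x : Fin m → ℝ) : ‖WithLp.toLp 2 x‖ ^ 2 = x ⬝ᵥ x := by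
  rw [EuclideanSpace.real_norm_sq_eq]
  simp [dotProduct, sq]

theorem dotProduct_mulVec_self_le {m n : ℕ} (A : Matrix (Fin m) (Fin n) ℝ) (x : Fin n → ℝ)
    {t : ℝ} (h : ‖A‖ ≤ t) : (A *ᵥ x) ⬝ᵥ (A *ᵥ x) ≤ t ^ 2 * (x ⬝ᵥ x) := by
  rw [← sq_norm_toLp, ← sq_norm_toLp, ← mul_pow]
  have h1 := A.l2_opNorm_mulVec (WithLp.toLp 2 x)
  refine pow_le_pow_left₀ (norm_nonneg _) (h1.trans ?_) 2
  gcongr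

theorem norm_le_of_dotProduct_mulVec_self_le {m n : ℕ} (A : Matrix (Fin m) (Fin n) ℝ) {t : ℝ}
    (ht : 0 ≤ t) (h : ∀ x, (A *ᵥ x) ⬝ᵥ (A *ᵥ x) ≤ t ^ 2 * (x ⬝ᵥ x)) : ‖A‖ ≤ t := by
  refine ContinuousLinearMap.opNorm_le_bound _ ht fun x => ?_
  have h1 := h x.ofLp
  rw [← sq_norm_toLp, ← sq_norm_toLp, ← mul_pow] at h1
  exact le_of_sq_le_sq h1 (by positivity)

theorem norm_transpose_mul_self {m n : ℕ} (A : Matrix (Fin m) (Fin n) ℝ) :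
    ‖Aᵀ * A‖ = ‖A‖ * ‖A‖ := by
  rw [← A.l2_opNorm_conjTranspose_mul_self, conjTranspose_eq_transpose_of_trivial]

theorem norm_transpose_real {m n : ℕ} (A : Matrix (Fin m) (Fin n) ℝ) : ‖Aᵀ‖ = ‖A‖ := by
  rw [← A.l2_opNorm_conjTranspose, conjTranspose_eq_transpose_of_trivial]

theorem norm_one_le_one (m : ℕ) : ‖(1 : Matrix (Fin m) (Fin m) ℝ)‖ ≤ 1 := by
  rw [← diagonal_one, l2_opNorm_diagonal, pi_norm_le_iff_of_nonneg zero_le_one]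
  simp

theorem norm_le_one_of_transpose_mul_self {m n : ℕ} {A : Matrix (Fin m) (Fin n) ℝ}
    (h : Aᵀ * A = 1) : ‖A‖ ≤ 1 := by
  have h1 := norm_transpose_mul_self A
  rw [h] at h1
  nlinarith [norm_one_le_one n, norm_nonneg A]

theorem norm_mul_mul_le_of_norm_le_one {k l m n : ℕ} {A : Matrix (Fin k) (Fin l) ℝ}
    {X : Matrix (Fin l) (Fin m) ℝ} {C : Matrix (Fin m) (Fin n) ℝ} (hA : ‖A‖ ≤ 1)
    (hC : ‖C‖ ≤ 1) : ‖A * X * C‖ ≤ ‖X‖ :=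
  calc ‖A * X * C‖ ≤ ‖A‖ * ‖X‖ * ‖C‖ :=
        (l2_opNorm_mul _ _).trans (by gcongr; exact l2_opNorm_mul _ _)
    _ ≤ 1 * ‖X‖ * 1 := by gcongr
    _ = ‖X‖ := by ring

theorem transpose_mul_self_sub_proj {n r : ℕ} {U V : Matrix (Fin n) (Fin r) ℝ}
    (hU : Uᵀ * U = 1) (hV : Vᵀ * V = 1) :
    (U - V * (Vᵀ * U))ᵀ * (U - V * (Vᵀ * U)) = 1 - (Vᵀ * U)ᵀ * (Vᵀ * U) := by
  have h : Vᵀ * (U - V * (Vᵀ * U)) = 0 := by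
    rw [Matrix.mul_sub, ← Matrix.mul_assoc Vᵀ V, hV, Matrix.one_mul, sub_self]
  have h2 : (U - V * (Vᵀ * U))ᵀ * (U - V * (Vᵀ * U)) = Uᵀ * (U - V * (Vᵀ * U)) := by
    rw [transpose_sub, Matrix.sub_mul, transpose_mul V, Matrix.mul_assoc _ Vᵀ, h,
      Matrix.mul_zero, sub_zero]
  rw [h2, Matrix.mul_sub, hU, transpose_mul, transpose_transpose]
  simp only [Matrix.mul_assoc]

theorem norm_one_sub_proj_le_one {n r : ℕ} {V : Matrix (Fin n) (Fin r) ℝ} (hV : Vᵀ * V = 1) :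
    ‖1 - V * Vᵀ‖ ≤ 1 := by
  have h : (1 - V * Vᵀ)ᵀ * (1 - V * Vᵀ) = 1 - V * Vᵀ := by
    have : V * Vᵀ * (V * Vᵀ) = V * Vᵀ := by
      rw [Matrix.mul_assoc, ← Matrix.mul_assoc Vᵀ, hV, Matrix.one_mul]
    simp [transpose_sub, transpose_mul, Matrix.sub_mul, Matrix.mul_sub, this]
  have h1 := norm_transpose_mul_self (1 - V * Vᵀ)
  rw [h] at h1
  nlinarith [norm_nonneg (1 - V * Vᵀ)]

/-- For orthonormal frames `U`, `V` of equal size, a bound on both cross projections bounds the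
difference of the orthogonal projections. -/
theorem norm_proj_sub_proj_le {n r : ℕ} {U V : Matrix (Fin n) (Fin r) ℝ}
    (hU : Uᵀ * U = 1) (hV : Vᵀ * V = 1) {t : ℝ} (ht : 0 ≤ t)
    (hUV : ‖U - V * (Vᵀ * U)‖ ≤ t) (hVU : ‖V - U * (Uᵀ * V)‖ ≤ t) :
    ‖U * Uᵀ - V * Vᵀ‖ ≤ t := by
  refine norm_le_of_dotProduct_mulVec_self_le _ ht fun x => ?_
  set N := U - V * (Vᵀ * U) with hN
  set N' := V - U * (Uᵀ * V) with hN'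
  have hVN : Vᵀ * N = 0 := by
    rw [hN, Matrix.mul_sub, ← Matrix.mul_assoc Vᵀ V, hV, Matrix.one_mul, sub_self]
  have hUN : Uᵀ * N' = 0 := by
    rw [hN', Matrix.mul_sub, ← Matrix.mul_assoc Uᵀ U, hU, Matrix.one_mul, sub_self]
  have hNU : N'ᵀ * U = 0 := by
    rw [← transpose_transpose U, ← transpose_mul, hUN, transpose_zero]
  have hdec : U * Uᵀ - V * Vᵀ = N * Uᵀ - V * N'ᵀ := by
    rw [hN, hN']
    simp only [transpose_sub, transpose_mul, transpose_transpose, Matrix.sub_mul,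
      Matrix.mul_sub, Matrix.mul_assoc]
    abel
  set y := Uᵀ *ᵥ x with hy
  set z := N'ᵀ *ᵥ x with hz
  set w := x - U *ᵥ y with hw
  have hx : (U * Uᵀ - V * Vᵀ) *ᵥ x = N *ᵥ y - V *ᵥ z := by
    rw [hdec, sub_mulVec, ← mulVec_mulVec, ← mulVec_mulVec]
  have hzw : z = N'ᵀ *ᵥ w := by
    rw [hw, mulVec_sub, mulVec_mulVec, hNU, zero_mulVec, sub_zero]
  have hcross : (N *ᵥ y) ⬝ᵥ (V *ᵥ z) = 0 := by
    rw [dotProduct_mulVec, ← mulVec_transpose, mulVec_mulVec, hVN, zero_mulVec,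
      zero_dotProduct]
  have hVz : (V *ᵥ z) ⬝ᵥ (V *ᵥ z) = z ⬝ᵥ z := by
    rw [dotProduct_mulVec, ← mulVec_transpose, mulVec_mulVec, hV, one_mulVec]
  have hUy : (U *ᵥ y) ⬝ᵥ (U *ᵥ y) = y ⬝ᵥ y := by
    rw [dotProduct_mulVec, ← mulVec_transpose, mulVec_mulVec, hU, one_mulVec]
  have hxU : x ⬝ᵥ (U *ᵥ y) = y ⬝ᵥ y := by
    rw [dotProduct_mulVec, ← mulVec_transpose]
  have hww : w ⬝ᵥ w = x ⬝ᵥ x - y ⬝ᵥ y := by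
    rw [hw, sub_dotProduct, dotProduct_sub, dotProduct_sub, dotProduct_comm (U *ᵥ y) x, hxU,
      hUy]
    ring
  have h1 := dotProduct_mulVec_self_le N y hUV
  have h2 := dotProduct_mulVec_self_le N'ᵀ w ((norm_transpose_real N').trans_le hVU)
  rw [← hzw, hww] at h2
  rw [hx, sub_dotProduct, dotProduct_sub, dotProduct_sub, dotProduct_comm (V *ᵥ z), hcross,
    hVz]
  linarith

/-- Consequences, in terms of a singular value decomposition of `Vᵀ * U`, of a bound on the part
of `U` orthogonal to the range of `V`. -/
theorem norm_le_of_svd {n r : ℕ} {U V : Matrix (Fin n) (Fin r) ℝ}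
    (hU : Uᵀ * U = 1) (hV : Vᵀ * V = 1) {F₁ F₂ : Matrix (Fin r) (Fin r) ℝ} {s : Fin r → ℝ}
    (hF₁ : F₁ᵀ * F₁ = 1 ∧ F₁ * F₁ᵀ = 1) (hF₂ : F₂ᵀ * F₂ = 1 ∧ F₂ * F₂ᵀ = 1)
    (hs : ∀ k, 0 ≤ s k) (hSVD : Vᵀ * U = F₁ * diagonal s * F₂ᵀ) {t : ℝ} (ht : 0 ≤ t)
    (hUV : ‖U - V * (Vᵀ * U)‖ ≤ t) :
    ‖V - U * (Uᵀ * V)‖ ≤ t ∧ ‖Vᵀ * U - F₁ * F₂ᵀ‖ ≤ t ^ 2 := by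
  have nF₁ := norm_le_one_of_transpose_mul_self hF₁.1
  have nF₂ := norm_le_one_of_transpose_mul_self hF₂.1
  set N := U - V * (Vᵀ * U) with hN
  have hone : (diagonal fun k => 1 - s k * s k) = 1 - diagonal s * diagonal s := by
    rw [diagonal_mul_diagonal, ← diagonal_one, diagonal_sub]
  have hdiag : (N * F₂)ᵀ * (N * F₂) = diagonal fun k => 1 - s k * s k := by
    have h0 : (N * F₂)ᵀ * (N * F₂) = F₂ᵀ * (Nᵀ * N) * F₂ := by
      simp only [transpose_mul, Matrix.mul_assoc]
    have h1 : F₂ᵀ * (F₂ * diagonal s * (F₁ᵀ * F₁) * diagonal s * F₂ᵀ) * F₂ =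
        (F₂ᵀ * F₂) * diagonal s * (F₁ᵀ * F₁) * diagonal s * (F₂ᵀ * F₂) := by
      simp only [Matrix.mul_assoc]
    have h2 : (F₁ * diagonal s * F₂ᵀ)ᵀ * (F₁ * diagonal s * F₂ᵀ) =
        F₂ * diagonal s * (F₁ᵀ * F₁) * diagonal s * F₂ᵀ := by
      simp only [transpose_mul, transpose_transpose, diagonal_transpose, Matrix.mul_assoc]
    rw [h0, hN, transpose_mul_self_sub_proj hU hV, hSVD, h2, Matrix.mul_sub, Matrix.sub_mul,
      h1, hF₁.1, Matrix.mul_one, hF₂.1, Matrix.one_mul, Matrix.mul_one, Matrix.mul_one, hone]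
  have hNF : ‖N * F₂‖ ≤ t :=
    (l2_opNorm_mul _ _).trans <| (mul_le_mul hUV nF₂ (norm_nonneg _) ht).trans_eq (mul_one t)
  have hdn : ‖fun k => 1 - s k * s k‖ ≤ t ^ 2 := by
    rw [← l2_opNorm_diagonal, ← hdiag, norm_transpose_mul_self, ← sq]
    exact pow_le_pow_left₀ (norm_nonneg _) hNF 2
  have hup : ∀ k, 1 - s k * s k ≤ t ^ 2 := fun k =>
    (le_abs_self _).trans ((norm_le_pi_norm (fun k => 1 - s k * s k) k).trans hdn)
  have hlow : ∀ k, 0 ≤ 1 - s k * s k := fun k => by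
    have h := congrFun (congrFun hdiag k) k
    rw [diagonal_apply_eq] at h
    rw [← h, Matrix.mul_apply]
    exact Finset.sum_nonneg fun i _ => mul_self_nonneg _
  constructor
  · have hSVD' : Uᵀ * V = F₂ * diagonal s * F₁ᵀ := by
      rw [← transpose_transpose V, ← transpose_mul, hSVD]
      simp only [transpose_mul, transpose_transpose, diagonal_transpose, Matrix.mul_assoc]
    have h1 : (V - U * (Uᵀ * V))ᵀ * (V - U * (Uᵀ * V)) =
        F₁ * (diagonal fun k => 1 - s k * s k) * F₁ᵀ := by
      have h2 : (F₂ * diagonal s * F₁ᵀ)ᵀ * (F₂ * diagonal s * F₁ᵀ) =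
          F₁ * (diagonal s * (F₂ᵀ * F₂) * diagonal s) * F₁ᵀ := by
        simp only [transpose_mul, transpose_transpose, diagonal_transpose, Matrix.mul_assoc]
      rw [transpose_mul_self_sub_proj hV hU, hSVD', h2, hF₂.1, Matrix.mul_one, hone,
        Matrix.mul_sub, Matrix.sub_mul, Matrix.mul_one, hF₁.2]
    refine le_of_sq_le_sq ?_ ht
    rw [sq, ← norm_transpose_mul_self, h1]
    refine (norm_mul_mul_le_of_norm_le_one nF₁ ((norm_transpose_real F₁).trans_le nF₁)).trans ?_
    rwa [l2_opNorm_diagonal]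
  · have h1 : Vᵀ * U - F₁ * F₂ᵀ = F₁ * (diagonal fun k => s k - 1) * F₂ᵀ := by
      have : (diagonal fun k => s k - 1) = diagonal s - 1 := by
        rw [← diagonal_one, diagonal_sub]
      rw [this, hSVD, Matrix.mul_sub, Matrix.sub_mul, Matrix.mul_one]
    rw [h1]
    refine (norm_mul_mul_le_of_norm_le_one nF₁ ((norm_transpose_real F₂).trans_le nF₂)).trans ?_
    rw [l2_opNorm_diagonal, pi_norm_le_iff_of_nonneg (by positivity)]
    intro k
    rw [Real.norm_eq_abs, abs_le]
    have := hup k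
    have := hlow k
    have := hs k
    have hle : s k ≤ 1 := by nlinarith
    constructor <;> nlinarith

theorem firstCols_transpose_mul_self {n r : ℕ} (h : r ≤ n) {O : Matrix (Fin n) (Fin n) ℝ}
    (hO : Oᵀ * O = 1) : (firstCols h O)ᵀ * firstCols h O = 1 := by
  ext i j
  have h1 := congrFun (congrFun hO (Fin.castLE h i)) (Fin.castLE h j)
  rw [Matrix.one_apply] at h1
  rw [Matrix.one_apply]
  simpa [Matrix.mul_apply, firstCols, Fin.ext_iff] using h1

theorem mul_firstCols {n r : ℕ} (h : r ≤ n) {A O : Matrix (Fin n) (Fin n) ℝ} {ν : Fin n → ℝ}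
    (hO : Oᵀ * O = 1) (hA : A = O * diagonal ν * Oᵀ) :
    A * firstCols h O = firstCols h O * diagonal fun k => ν (Fin.castLE h k) := by
  have h1 : A * O = O * diagonal ν := by
    rw [hA, Matrix.mul_assoc, hO, Matrix.mul_one]
  ext i k
  have h2 := congrFun (congrFun h1 i) (Fin.castLE h k)
  rw [mul_diagonal] at h2
  rw [mul_diagonal]
  exact h2

theorem eq_firstCols_mul {n r : ℕ} (h : r ≤ n) {B O : Matrix (Fin n) (Fin n) ℝ}
    {ρ : Fin n → ℝ} (hB : B = O * diagonal ρ * Oᵀ) (hρ : ∀ i : Fin n, r ≤ (i : ℕ) → ρ i = 0) :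
    B = firstCols h O * ((diagonal fun k => ρ (Fin.castLE h k)) * (firstCols h O)ᵀ) := by
  rw [hB, ← Matrix.mul_assoc]
  ext i j
  rw [Matrix.mul_apply, Matrix.mul_apply]
  simp only [mul_diagonal, transpose_apply]
  symm
  refine Fintype.sum_of_injective (Fin.castLE h) (Fin.castLE_injective h) _ _ ?_ fun k => rfl
  intro k hk
  rw [hρ k, mul_zero, zero_mul]
  by_contra hlt
  exact hk ⟨⟨k, not_le.mp hlt⟩, rfl⟩

/-- If a Gram matrix of rank at most `r` has positive leading `r` eigenvalues, the remaining
eigenvalues vanish. -/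
theorem eigenvalue_eq_zero_of_rank_le {n r : ℕ} (h : r ≤ n) (Φ : Matrix (Fin n) (Fin r) ℝ)
    {O : Matrix (Fin n) (Fin n) ℝ} {ρ : Fin n → ℝ} (hO : Oᵀ * O = 1)
    (hΦ : Φ * Φᵀ = O * diagonal ρ * Oᵀ) (hpos : ∀ k : Fin r, 0 < ρ (Fin.castLE h k))
    (i : Fin n) (hi : r ≤ (i : ℕ)) : ρ i = 0 := by
  by_contra hne
  have hd : diagonal ρ = Oᵀ * (Φ * (Φᵀ * O)) := by
    have h1 : Oᵀ * (Φ * (Φᵀ * O)) = Oᵀ * (Φ * Φᵀ) * O := by simp only [Matrix.mul_assoc]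
    have h2 : Oᵀ * (O * diagonal ρ * Oᵀ) * O = (Oᵀ * O) * diagonal ρ * (Oᵀ * O) := by
      simp only [Matrix.mul_assoc]
    rw [h1, hΦ, h2, hO, Matrix.one_mul, Matrix.mul_one]
  have hrank : (diagonal ρ).rank ≤ r := by
    rw [hd]
    refine (rank_mul_le_right _ _).trans ((rank_mul_le_left _ _).trans ?_)
    simpa using Φ.rank_le_width
  rw [rank_diagonal] at hrank
  let g : Option (Fin r) → {j // ρ j ≠ 0} := fun o =>
    o.elim ⟨i, hne⟩ fun k => ⟨Fin.castLE h k, (hpos k).ne'⟩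
  have hg : Function.Injective g := by
    rintro (_ | a) (_ | b) hab
    · rfl
    · have := congrArg (fun j => (j.1 : ℕ)) hab
      simp [g] at this
      omega
    · have := congrArg (fun j => (j.1 : ℕ)) hab
      simp [g] at this
      omega
    · have := congrArg (fun j => (j.1 : ℕ)) hab
      simp [g] at this
      rw [Fin.ext this]
  have := Fintype.card_le_of_injective g hg
  rw [Fintype.card_option, Fintype.card_fin] at this
  omega

/-- One-sided `sin Θ` bound: `U` spans an invariant subspace of `A` on which `A` is bounded below
by `c`, and `B` has range inside that of `V`. -/
theorem norm_sub_proj_le {n r : ℕ} {U V : Matrix (Fin n) (Fin r) ℝ}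
    {A B : Matrix (Fin n) (Fin n) ℝ} {X : Matrix (Fin r) (Fin n) ℝ} {d : Fin r → ℝ}
    (hU : Uᵀ * U = 1) (hV : Vᵀ * V = 1) (hA : A * U = U * diagonal d) (hB : B = V * X)
    {c e : ℝ} (hc : 0 < c) (hd : ∀ k, c ≤ d k) (he : ‖A - B‖ ≤ e) :
    ‖U - V * (Vᵀ * U)‖ ≤ e / c := by
  have hdd : diagonal d * diagonal (fun k => (d k)⁻¹) = 1 := by
    rw [diagonal_mul_diagonal, ← diagonal_one]
    congr 1
    ext k
    exact mul_inv_cancel₀ (hc.trans_le (hd k)).ne'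
  have hQB : (1 - V * Vᵀ) * B = 0 := by
    rw [hB, ← Matrix.mul_assoc, Matrix.sub_mul, Matrix.mul_assoc V, hV, Matrix.one_mul,
      Matrix.mul_one, sub_self, Matrix.zero_mul]
  have hN : U - V * (Vᵀ * U) =
      (1 - V * Vᵀ) * (A - B) * U * diagonal fun k => (d k)⁻¹ := by
    rw [Matrix.mul_sub, hQB, sub_zero, Matrix.mul_assoc _ A, hA, Matrix.mul_assoc _ (U * _),
      Matrix.mul_assoc U, hdd, Matrix.mul_one, Matrix.sub_mul, Matrix.one_mul, Matrix.mul_assoc]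
  have hinv : ‖diagonal fun k => (d k)⁻¹‖ ≤ c⁻¹ := by
    rw [l2_opNorm_diagonal, pi_norm_le_iff_of_nonneg (by positivity)]
    intro k
    have := hc.trans_le (hd k)
    rw [Real.norm_eq_abs, abs_of_pos (by positivity)]
    exact inv_anti₀ hc (hd k)
  have he0 : 0 ≤ e := (norm_nonneg _).trans he
  rw [hN, div_eq_mul_inv]
  refine (l2_opNorm_mul _ _).trans (mul_le_mul ?_ hinv (norm_nonneg _) he0)
  exact (norm_mul_mul_le_of_norm_le_one (norm_one_sub_proj_le_one hV)
    (norm_le_one_of_transpose_mul_self hU)).trans he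

theorem norm_le_of_norm_sub_smul_one_le {n : ℕ} {A : Matrix (Fin n) (Fin n) ℝ} {σ e : ℝ}
    (h : specNorm (A - σ ^ 2 • (1 : Matrix (Fin n) (Fin n) ℝ)) ≤ e) : ‖A‖ ≤ e + σ ^ 2 := by
  have h1 : ‖σ ^ 2 • (1 : Matrix (Fin n) (Fin n) ℝ)‖ ≤ σ ^ 2 := by
    rw [norm_smul, Real.norm_of_nonneg (sq_nonneg σ)]
    exact mul_le_of_le_one_right (sq_nonneg σ) (norm_one_le_one n)
  calc ‖A‖ = ‖A - σ ^ 2 • (1 : Matrix (Fin n) (Fin n) ℝ) + σ ^ 2 • 1‖ := by rw [sub_add_cancel]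
    _ ≤ e + σ ^ 2 := (norm_add_le _ _).trans (add_le_add h h1)

end L2Operator

/-- Davis–Kahan type bounds.  Under the Latent Metric Space model with
(A1) and (A3), on the event `A₁(ε₁) ∩ A₂(ε₂)` one has
`‖U_Y U_Yᵀ − U_Φ U_Φᵀ‖₂ ≤ (ε₁ + n⁻¹σ²)/(λ_r^f (1 − 2ε₂))` and
`‖U_Φᵀ U_Y − F⋆‖₂ ≤ ((ε₁ + n⁻¹σ²)/(λ_r^f (1 − 2ε₂)))²`. -/
theorem davis_kahan_bounds {n p r : ℕ}
    (hp : 0 < p) (hn : 0 < n) (hr0 : 0 < r) (hrn : r ≤ n)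
    (Y : Matrix (Fin n) (Fin p) ℝ) (Φ : Matrix (Fin n) (Fin r) ℝ) (σ : ℝ)
    -- Mercer eigenvalues of the rank-r kernel f (assumption (A3))
    (lam : Fin r → ℝ) (hlam_pos : ∀ k, 0 < lam k) (hlam_mono : Antitone lam)
    -- full sorted eigendecomposition of `p⁻¹ • (Y Yᵀ)`
    (OY : Matrix (Fin n) (Fin n) ℝ) (ν : Fin n → ℝ)
    (hOY : OYᵀ * OY = 1)
    (hYdec : (p : ℝ)⁻¹ • (Y * Yᵀ) = OY * Matrix.diagonal ν * OYᵀ)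
    (hν : Antitone ν)
    -- full sorted eigendecomposition of `Φ Φᵀ`
    (OΦ : Matrix (Fin n) (Fin n) ℝ) (ρ : Fin n → ℝ)
    (hOΦ : OΦᵀ * OΦ = 1)
    (hΦdec : Φ * Φᵀ = OΦ * Matrix.diagonal ρ * OΦᵀ)
    (hρ : Antitone ρ)
    -- full singular value decomposition `F₁ Σ F₂ᵀ` of `U_Φᵀ U_Y`, and `F⋆ := F₁ F₂ᵀ`
    (F₁ F₂ : Matrix (Fin r) (Fin r) ℝ) (s : Fin r → ℝ)
    (hF₁ : F₁ᵀ * F₁ = 1 ∧ F₁ * F₁ᵀ = 1) (hF₂ : F₂ᵀ * F₂ = 1 ∧ F₂ * F₂ᵀ = 1)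
    (hs : ∀ k, 0 ≤ s k)
    (hSVD : (firstCols hrn OΦ)ᵀ * firstCols hrn OY = F₁ * Matrix.diagonal s * F₂ᵀ)
    (ε₁ ε₂ : ℝ) (hε₁ : 0 < ε₁) (hε₂ : 0 < ε₂) (hε₂' : ε₂ < 1/2)
    -- the event A₁(ε₁)
    (hA1 : specNorm ((p : ℝ)⁻¹ • (Y * Yᵀ) - Φ * Φᵀ
        - σ ^ 2 • (1 : Matrix (Fin n) (Fin n) ℝ)) ≤ ε₁ * n)
    -- the event A₂(ε₂)
    (hA2Y : ∀ k : Fin r,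
      lam k * (1 - ε₂) ≤ (n : ℝ)⁻¹ * ν (Fin.castLE hrn k) ∧
      (n : ℝ)⁻¹ * ν (Fin.castLE hrn k) ≤ lam k * (1 + ε₂))
    (hA2Y' : ∀ i : Fin n, r ≤ (i : ℕ) →
      (n : ℝ)⁻¹ * ν i ≤ ε₂ * lam ⟨r - 1, Nat.sub_lt hr0 one_pos⟩)
    (hA2Φ : ∀ k : Fin r,
      (1 - ε₂) * lam k ≤ (n : ℝ)⁻¹ * ρ (Fin.castLE hrn k) ∧
      (n : ℝ)⁻¹ * ρ (Fin.castLE hrn k) ≤ (1 + ε₂) * lam k) :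
    specNorm (firstCols hrn OY * (firstCols hrn OY)ᵀ
        - firstCols hrn OΦ * (firstCols hrn OΦ)ᵀ)
      ≤ (ε₁ + (n : ℝ)⁻¹ * σ ^ 2)
          / (lam ⟨r - 1, Nat.sub_lt hr0 one_pos⟩ * (1 - 2 * ε₂)) ∧
    specNorm ((firstCols hrn OΦ)ᵀ * firstCols hrn OY - F₁ * F₂ᵀ)
      ≤ ((ε₁ + (n : ℝ)⁻¹ * σ ^ 2)
          / (lam ⟨r - 1, Nat.sub_lt hr0 one_pos⟩ * (1 - 2 * ε₂))) ^ 2 := by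
  have hn' : (0 : ℝ) < n := Nat.cast_pos.mpr hn
  set l := lam ⟨r - 1, Nat.sub_lt hr0 one_pos⟩ with hl
  have hl0 : 0 < l := hlam_pos _
  have hlk : ∀ k, l ≤ lam k := fun k => hlam_mono (Fin.le_def.mpr (Nat.le_sub_one_of_lt k.2))
  have hρpos : ∀ k : Fin r, 0 < ρ (Fin.castLE hrn k) := fun k => by
    have h1 : 0 < (n : ℝ)⁻¹ * ρ (Fin.castLE hrn k) :=
      (mul_pos (by linarith) (hlam_pos k)).trans_le (hA2Φ k).1
    exact pos_of_mul_pos_right h1 (by positivity)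
  have hρ0 := eigenvalue_eq_zero_of_rank_le hrn Φ hOΦ hΦdec hρpos
  have hU := firstCols_transpose_mul_self hrn hOY
  have hV := firstCols_transpose_mul_self hrn hOΦ
  have hc : 0 < n * (l * (1 - 2 * ε₂)) := mul_pos hn' (mul_pos hl0 (by linarith))
  have hd : ∀ k : Fin r, n * (l * (1 - 2 * ε₂)) ≤ ν (Fin.castLE hrn k) := fun k => by
    rw [← le_inv_mul_iff₀ hn']
    refine le_trans ?_ (hA2Y k).1
    exact mul_le_mul (hlk k) (by linarith) (by linarith) (hlam_pos k).le
  set t := (ε₁ + (n : ℝ)⁻¹ * σ ^ 2) / (l * (1 - 2 * ε₂)) with ht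
  have ht0 : 0 ≤ t := div_nonneg (by positivity) (mul_nonneg hl0.le (by linarith))
  have hUV : specNorm (firstCols hrn OY
      - firstCols hrn OΦ * ((firstCols hrn OΦ)ᵀ * firstCols hrn OY)) ≤ t := by
    refine (norm_sub_proj_le hU hV (mul_firstCols hrn hOY hYdec)
      (eq_firstCols_mul hrn hΦdec hρ0) hc hd (norm_le_of_norm_sub_smul_one_le hA1)).trans_eq ?_
    rw [ht, show ε₁ * n + σ ^ 2 = n * (ε₁ + (n : ℝ)⁻¹ * σ ^ 2) by field_simp]
    exact mul_div_mul_left _ _ hn'.ne'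
  obtain ⟨hVU, hF⟩ := norm_le_of_svd hU hV hF₁ hF₂ hs hSVD ht0 hUV
  exact ⟨norm_proj_sub_proj_le hU hV ht0 hUV hVU, hF⟩
end

section
/- Assume (A1) and (A4). If for a given function η : [0,1] → Z the function (s,s') ∈ [0,1]² ↦ f(η_s, η_{s'}) has a mixed partial derivative ∂²f(η_s,η_{s'})/∂s∂s' that is continuous everywhere on [0,1]², then γ : [0,1] → M defined by γ_t := φ(η_t) is a curve in M; moreover for all t,t' ∈ [0,1], ⟨γ̇_t, γ̇_{t'}⟩₂ = ∂²f(η_s,η_{s'})/∂s∂s' at (t,t'), and ∫₀¹ ‖γ̇_t‖₂ dt = ∫₀¹ | ∂²f(η_s,η_{s'})/∂s∂s' at (t,t) |^{1/2} dt. -/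
open Set
open scoped RealInnerProductSpace

section UnitInterval

open Filter Topology

/-- The mean value theorem on the unit interval, without assuming `a ≤ b`. -/
lemma exists_uIcc_sub_eq_mul_of_hasDerivWithinAt {F F' : ℝ → ℝ}
    (hF : ∀ x ∈ Icc (0:ℝ) 1, HasDerivWithinAt F (F' x) (Icc (0:ℝ) 1) x)
    {a b : ℝ} (ha : a ∈ Icc (0:ℝ) 1) (hb : b ∈ Icc (0:ℝ) 1) :
    ∃ ξ ∈ uIcc a b, F b - F a = (b - a) * F' ξ := by
  wlog hab : a ≤ b generalizing a b
  · obtain ⟨ξ, hξ, h⟩ := this hb ha (le_of_not_ge hab)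
    exact ⟨ξ, uIcc_comm b a ▸ hξ, by linear_combination -h⟩
  rcases hab.eq_or_lt with rfl | hlt
  · exact ⟨a, left_mem_uIcc, by ring⟩
  obtain ⟨ξ, hξ, h⟩ := exists_hasDerivAt_eq_slope F F' hlt
    (fun x hx => ((hF x ⟨ha.1.trans hx.1, hx.2.trans hb.2⟩).continuousWithinAt.mono
      (Icc_subset_Icc ha.1 hb.2)))
    (fun x hx => (hF x ⟨ha.1.trans hx.1.le, hx.2.le.trans hb.2⟩).hasDerivAt
      (Icc_mem_nhds (ha.1.trans_lt hx.1) (hx.2.trans_le hb.2)))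
  refine ⟨ξ, Icc_subset_uIcc (Ioo_subset_Icc_self hξ), ?_⟩
  rw [h]
  field_simp [(sub_pos.2 hlt).ne']

section KernelDerivative

variable {H : Type*} [NormedAddCommGroup H] [InnerProductSpace ℝ H]
  {γ : ℝ → H} {g1 g : ℝ → ℝ → ℝ}

/-- The inner product of two increments is a value of the mixed partial derivative of the
kernel, times the lengths of the parameter intervals. -/
lemma exists_inner_sub_sub_eq_mul
    (hg1 : ∀ s ∈ Icc (0:ℝ) 1, ∀ s' ∈ Icc (0:ℝ) 1,
      HasDerivWithinAt (fun v => ⟪γ s, γ v⟫) (g1 s s') (Icc (0:ℝ) 1) s')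
    (hg : ∀ s' ∈ Icc (0:ℝ) 1, ∀ s ∈ Icc (0:ℝ) 1,
      HasDerivWithinAt (fun v => g1 v s') (g s s') (Icc (0:ℝ) 1) s)
    {a b c d : ℝ} (ha : a ∈ Icc (0:ℝ) 1) (hb : b ∈ Icc (0:ℝ) 1)
    (hc : c ∈ Icc (0:ℝ) 1) (hd : d ∈ Icc (0:ℝ) 1) :
    ∃ ξ ∈ uIcc a b, ∃ ζ ∈ uIcc c d,
      ⟪γ b - γ a, γ d - γ c⟫ = (b - a) * (d - c) * g ξ ζ := by
  obtain ⟨ζ, hζ, h⟩ := exists_uIcc_sub_eq_mul_of_hasDerivWithinAt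
    (fun v hv => (hg1 b hb v hv).sub (hg1 a ha v hv)) hc hd
  obtain ⟨ξ, hξ, h'⟩ := exists_uIcc_sub_eq_mul_of_hasDerivWithinAt
    (hg ζ (ordConnected_Icc.uIcc_subset hc hd hζ)) ha hb
  refine ⟨ξ, hξ, ζ, hζ, ?_⟩
  simp only [Pi.sub_apply] at h
  simp only [inner_sub_left, inner_sub_right]
  linear_combination h + (d - c) * h'

lemma tendsto_inner_slope_slope
    (hg1 : ∀ s ∈ Icc (0:ℝ) 1, ∀ s' ∈ Icc (0:ℝ) 1,
      HasDerivWithinAt (fun v => ⟪γ s, γ v⟫) (g1 s s') (Icc (0:ℝ) 1) s')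
    (hg : ∀ s' ∈ Icc (0:ℝ) 1, ∀ s ∈ Icc (0:ℝ) 1,
      HasDerivWithinAt (fun v => g1 v s') (g s s') (Icc (0:ℝ) 1) s)
    (hgcont : ContinuousOn (fun ss : ℝ × ℝ => g ss.1 ss.2) (Icc (0:ℝ) 1 ×ˢ Icc (0:ℝ) 1))
    {t t' : ℝ} (ht : t ∈ Icc (0:ℝ) 1) (ht' : t' ∈ Icc (0:ℝ) 1) :
    Tendsto (fun p : ℝ × ℝ => ⟪slope γ t p.1, slope γ t' p.2⟫)
      (𝓝[Icc (0:ℝ) 1 \ {t}] t ×ˢ 𝓝[Icc (0:ℝ) 1 \ {t'}] t') (𝓝 (g t t')) := by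
  rw [← nhdsWithin_prod_eq, Metric.tendsto_nhdsWithin_nhds]
  intro ε hε
  obtain ⟨δ, hδ, h⟩ := Metric.continuousOn_iff.1 hgcont (t, t') ⟨ht, ht'⟩ ε hε
  refine ⟨δ, hδ, ?_⟩
  rintro ⟨s, s'⟩ ⟨⟨hs, hst⟩, ⟨hs', hst'⟩⟩ hd
  obtain ⟨ξ, hξ, ζ, hζ, e⟩ := exists_inner_sub_sub_eq_mul hg1 hg ht hs ht' hs'
  have hst0 : s - t ≠ 0 := sub_ne_zero.2 hst
  have hst0' : s' - t' ≠ 0 := sub_ne_zero.2 hst'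
  have key : ⟪slope γ t s, slope γ t' s'⟫ = g ξ ζ := by
    simp only [slope_def_module, real_inner_smul_left, real_inner_smul_right, e]
    field_simp
  simp only [key]
  refine h (ξ, ζ) ⟨ordConnected_Icc.uIcc_subset ht hs hξ,
    ordConnected_Icc.uIcc_subset ht' hs' hζ⟩ (lt_of_le_of_lt ?_ hd)
  simp only [Prod.dist_eq, Real.dist_eq]
  exact max_le_max (abs_sub_left_of_mem_uIcc hξ) (abs_sub_left_of_mem_uIcc hζ)

lemma neBot_nhdsWithin_Icc_diff_singleton {t : ℝ} (ht : t ∈ Icc (0:ℝ) 1) :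
    (𝓝[Icc (0:ℝ) 1 \ {t}] t).NeBot :=
  accPt_principal_iff_nhdsWithin.1 ((uniqueDiffOn_Icc_zero_one t ht).accPt)

lemma exists_hasDerivWithinAt_of_kernel_derivative [CompleteSpace H]
    (hg1 : ∀ s ∈ Icc (0:ℝ) 1, ∀ s' ∈ Icc (0:ℝ) 1,
      HasDerivWithinAt (fun v => ⟪γ s, γ v⟫) (g1 s s') (Icc (0:ℝ) 1) s')
    (hg : ∀ s' ∈ Icc (0:ℝ) 1, ∀ s ∈ Icc (0:ℝ) 1,
      HasDerivWithinAt (fun v => g1 v s') (g s s') (Icc (0:ℝ) 1) s)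
    (hgcont : ContinuousOn (fun ss : ℝ × ℝ => g ss.1 ss.2) (Icc (0:ℝ) 1 ×ˢ Icc (0:ℝ) 1))
    {t : ℝ} (ht : t ∈ Icc (0:ℝ) 1) :
    ∃ v : H, HasDerivWithinAt γ v (Icc (0:ℝ) 1) t := by
  simp only [hasDerivWithinAt_iff_tendsto_slope]
  have := neBot_nhdsWithin_Icc_diff_singleton ht
  rw [← cauchy_map_iff_exists_tendsto, cauchy_map_iff]
  refine ⟨this, tendsto_uniformity_iff_dist_tendsto_zero.2 ?_⟩
  set l := 𝓝[Icc (0:ℝ) 1 \ {t}] t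
  have h := tendsto_inner_slope_slope hg1 hg hgcont ht ht
  have h1 : Tendsto (fun p : ℝ × ℝ => ⟪slope γ t p.1, slope γ t p.1⟫) (l ×ˢ l) (𝓝 (g t t)) :=
    h.comp (tendsto_fst.prodMk tendsto_fst)
  have h2 : Tendsto (fun p : ℝ × ℝ => ⟪slope γ t p.2, slope γ t p.2⟫) (l ×ˢ l) (𝓝 (g t t)) :=
    h.comp (tendsto_snd.prodMk tendsto_snd)
  have h3 := ((h1.sub (h.const_mul 2)).add h2).sqrt
  rw [show g t t - 2 * g t t + g t t = 0 by ring, Real.sqrt_zero] at h3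
  refine h3.congr fun p => ?_
  rw [dist_eq_norm, ← Real.sqrt_sq (norm_nonneg (_ - _)), norm_sub_sq_real,
    real_inner_self_eq_norm_sq, real_inner_self_eq_norm_sq]

end KernelDerivative

/-- A family of vectors whose Gram kernel is continuous is continuous. -/
lemma continuousOn_of_continuousOn_inner {X H : Type*} [TopologicalSpace X]
    [NormedAddCommGroup H] [InnerProductSpace ℝ H] {u : X → H} {S : Set X} {g : X → X → ℝ}
    (hu : ∀ t ∈ S, ∀ t' ∈ S, ⟪u t, u t'⟫ = g t t')
    (hgcont : ContinuousOn (fun p : X × X => g p.1 p.2) (S ×ˢ S)) : ContinuousOn u S := by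
  intro t ht
  refine tendsto_iff_dist_tendsto_zero.2 ?_
  have hd : ContinuousOn (fun s => g s s) S :=
    hgcont.comp (continuousOn_id.prodMk continuousOn_id) fun s hs => ⟨hs, hs⟩
  have hl : ContinuousOn (fun s => g s t) S :=
    hgcont.comp (continuousOn_id.prodMk continuousOn_const) fun s hs => ⟨hs, ht⟩
  have h := (((hd t ht).tendsto.sub ((hl t ht).tendsto.const_mul 2)).add_const (g t t)).sqrt
  rw [show g t t - 2 * g t t + g t t = 0 by ring, Real.sqrt_zero] at h
  refine h.congr' (eventually_nhdsWithin_of_forall fun s hs => ?_)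
  beta_reduce
  rw [dist_eq_norm, ← Real.sqrt_sq (norm_nonneg (_ - _)), norm_sub_sq_real,
    ← hu s hs s hs, ← hu s hs t ht, ← hu t ht t ht,
    real_inner_self_eq_norm_sq, real_inner_self_eq_norm_sq]

end UnitInterval

/-- Assume (A1) and (A4).  If `η : [0,1] → Z` is such that
`(s,s') ↦ f(η_s, η_{s'})` has a continuous mixed partial derivative `∂²f(η_s,η_{s'})/∂s∂s'`
on `[0,1]²`, then `γ_t := φ(η_t)` is a curve in `M = φ(Z)`, the inner products of its
derivative satisfy `⟪γ̇_t, γ̇_{t'}⟫ = ∂²f(η_s,η_{s'})/∂s∂s'|_{(t,t')}`, and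
`∫₀¹ ‖γ̇_t‖ dt = ∫₀¹ |∂²f(η_s,η_{s'})/∂s∂s'|_{(t,t)}|^{1/2} dt`. -/
theorem curve_image_of_kernel_derivative
    {Z : Type} [MetricSpace Z] [CompactSpace Z]
    (f : Z → Z → ℝ) (φ : Z → lp (fun _ : ℕ => ℝ) 2)
    (hker : ∀ z z', f z z' = ⟪φ z, φ z'⟫)
    -- (A1)
    (hcont : Continuous fun zz : Z × Z => f zz.1 zz.2)
    -- (A4)
    (hA4 : ∀ z z' : Z, z ≠ z' → ∃ ξ : Z, f z ξ ≠ f z' ξ)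
    (η : ℝ → Z) (g1 g : ℝ → ℝ → ℝ)
    -- `g1 s s'` is the partial derivative in `s'` of `(s,s') ↦ f(η_s, η_{s'})`
    (hg1 : ∀ s ∈ Icc (0:ℝ) 1, ∀ s' ∈ Icc (0:ℝ) 1,
      HasDerivWithinAt (fun v => f (η s) (η v)) (g1 s s') (Icc (0:ℝ) 1) s')
    -- `g s s'` is the partial derivative in `s` of `g1`, i.e. the mixed partial derivative
    (hg : ∀ s' ∈ Icc (0:ℝ) 1, ∀ s ∈ Icc (0:ℝ) 1,
      HasDerivWithinAt (fun v => g1 v s') (g s s') (Icc (0:ℝ) 1) s)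
    -- continuity of the mixed partial derivative on `[0,1]²`
    (hgcont : ContinuousOn (fun ss : ℝ × ℝ => g ss.1 ss.2) (Icc (0:ℝ) 1 ×ˢ Icc (0:ℝ) 1)) :
    ∃ γ' : ℝ → lp (fun _ : ℕ => ℝ) 2,
      IsCurveIn (Set.range φ) (fun t => φ (η t)) γ' ∧
      (∀ t ∈ Icc (0:ℝ) 1, ∀ t' ∈ Icc (0:ℝ) 1, ⟪γ' t, γ' t'⟫ = g t t') ∧
      ∫ t in (0:ℝ)..1, ‖γ' t‖ = ∫ t in (0:ℝ)..1, Real.sqrt |g t t| := by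
  simp only [hker] at hg1
  choose! γ' hγ' using fun (t : ℝ) (ht : t ∈ Icc (0:ℝ) 1) =>
    exists_hasDerivWithinAt_of_kernel_derivative (γ := fun t => φ (η t)) hg1 hg hgcont ht
  have hinner : ∀ t ∈ Icc (0:ℝ) 1, ∀ t' ∈ Icc (0:ℝ) 1, ⟪γ' t, γ' t'⟫ = g t t' := by
    intro t ht t' ht'
    have := neBot_nhdsWithin_Icc_diff_singleton ht
    have := neBot_nhdsWithin_Icc_diff_singleton ht'
    exact tendsto_nhds_unique
      (((hasDerivWithinAt_iff_tendsto_slope.1 (hγ' t ht)).comp Filter.tendsto_fst).inner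
        ((hasDerivWithinAt_iff_tendsto_slope.1 (hγ' t' ht')).comp Filter.tendsto_snd))
      (tendsto_inner_slope_slope (γ := fun t => φ (η t)) hg1 hg hgcont ht ht')
  refine ⟨γ', ⟨fun t _ => mem_range_self _, fun t ht => (hγ' t ht).continuousWithinAt, hγ',
    continuousOn_of_continuousOn_inner hinner hgcont⟩, hinner, ?_⟩
  refine intervalIntegral.integral_congr fun t ht => ?_
  rw [uIcc_of_le zero_le_one] at ht
  simp only [← hinner t ht t ht, real_inner_self_eq_norm_sq, abs_sq,
    Real.sqrt_sq (norm_nonneg _)]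
end
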